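/- arXiv:2602.13037 — 13 statements merged into one kernel-verified Lean document; each statement's English description precedes it below -/
import Mathlib

section
/- Let k ≥ 1 be an integer and let G be a k-degenerate finite simple graph on n vertices. Then for every natural number b with b ≥ 4·k·√(k+1)·√n (as real numbers), G is (k,b)-colorable. -/
/-- A set of vertices of a simple graph is independent if no two of its elements
are adjacent. -/
def IndepOn {V : Type*} (G : SimpleGraph V) (s : Set V) : Prop :=
  ∀ ⦃u : V⦄, u ∈ s → ∀ ⦃v : V⦄, v ∈ s → ¬ G.Adj u v

/-- A set of vertices is 2-independent if any two distinct elements are at distance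
greater than 2: they are non-adjacent and have no common neighbor. -/
def TwoIndepOn {V : Type*} (G : SimpleGraph V) (s : Set V) : Prop :=
  ∀ ⦃u : V⦄, u ∈ s → ∀ ⦃v : V⦄, v ∈ s → u ≠ v →
    ¬ G.Adj u v ∧ ∀ w : V, ¬ (G.Adj u w ∧ G.Adj w v)

/-- `G` is `(a,b)`-colorable: its vertex set can be partitioned into `a` independent
sets and `b` 2-independent sets (classes are allowed to be empty). -/
def ABColorable {V : Type*} (G : SimpleGraph V) (a b : ℕ) : Prop :=
  ∃ f : V → Fin a ⊕ Fin b,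
    (∀ i : Fin a, IndepOn G {v | f v = Sum.inl i}) ∧
    (∀ j : Fin b, TwoIndepOn G {v | f v = Sum.inr j})

/-- A graph is `k`-degenerate if every nonempty set `A` of vertices contains a vertex
with at most `k` neighbors inside `A`. -/
def KDegenerate {V : Type*} (G : SimpleGraph V) (k : ℕ) : Prop :=
  ∀ A : Set V, A.Nonempty → ∃ v ∈ A, {u ∈ A | G.Adj v u}.ncard ≤ k

/-- A degenerate finite graph has a degeneracy ordering: an injective ranking in which every vertex
has at most `k` neighbors of smaller rank. -/
theorem KDegenerate.exists_ranking {V : Type*} [Fintype V] {G : SimpleGraph V} {k : ℕ}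
    (hdeg : KDegenerate G k) :
    ∃ r : V → ℕ, Function.Injective r ∧ ∀ v, {u | G.Adj v u ∧ r u < r v}.ncard ≤ k := by
  classical
  suffices h : ∀ A : Finset V, ∃ r : V → ℕ, Set.InjOn r A ∧
      ∀ v ∈ A, {u | u ∈ A ∧ G.Adj v u ∧ r u < r v}.ncard ≤ k by
    obtain ⟨r, hr, h⟩ := h Finset.univ
    exact ⟨r, by simpa using hr, by simpa using h⟩
  intro A
  induction A using Finset.strongInduction with
  | H A ih =>
    rcases A.eq_empty_or_nonempty with rfl | hA
    · exact ⟨fun _ ↦ 0, by simp, by simp⟩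
    obtain ⟨v, hv, hvk⟩ := hdeg A hA
    obtain ⟨r, hr, hrk⟩ := ih (A.erase v) (Finset.erase_ssubset hv)
    have hlt : ∀ u, r u < Finset.univ.sup r + 1 :=
      fun u ↦ Nat.lt_succ_of_le (Finset.le_sup (f := r) (Finset.mem_univ u))
    refine ⟨Function.update r v (Finset.univ.sup r + 1), ?_, ?_⟩
    · intro x hx y hy hxy
      by_cases hxv : x = v <;> by_cases hyv : y = v
      · rw [hxv, hyv]
      · subst hxv
        rw [Function.update_self, Function.update_of_ne hyv] at hxy
        exact absurd hxy (hlt y).ne'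
      · subst hyv
        rw [Function.update_self, Function.update_of_ne hxv] at hxy
        exact absurd hxy (hlt x).ne
      · rw [Function.update_of_ne hyv, Function.update_of_ne hxv] at hxy
        exact hr (by simpa [hxv] using hx) (by simpa [hyv] using hy) hxy
    · intro x hx
      by_cases hxv : x = v
      · subst hxv
        refine (Set.ncard_le_ncard ?_ (Set.toFinite _)).trans hvk
        exact fun u hu ↦ ⟨hu.1, hu.2.1⟩
      · refine (Set.ncard_le_ncard ?_ (Set.toFinite _)).trans
          (hrk x (Finset.mem_erase.2 ⟨hxv, hx⟩))
        rintro u ⟨hu, hxu, hur⟩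
        rw [Function.update_of_ne hxv] at hur
        by_cases huv : u = v
        · subst huv
          rw [Function.update_self] at hur
          exact absurd hur (hlt x).not_gt
        · rw [Function.update_of_ne huv] at hur
          exact ⟨Finset.mem_erase.2 ⟨huv, hu⟩, hxu, hur⟩

open Classical in
/-- The neighbors of `v` whose rank is smaller than that of `v`. -/
noncomputable def SimpleGraph.backNeighbors {V : Type*} [Fintype V] (G : SimpleGraph V)
    (r : V → ℕ) (v : V) : Finset V :=
  {u | G.Adj v u ∧ r u < r v}

theorem SimpleGraph.mem_backNeighbors {V : Type*} [Fintype V] {G : SimpleGraph V} {r : V → ℕ}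
    {u v : V} : u ∈ G.backNeighbors r v ↔ G.Adj v u ∧ r u < r v := by
  simp [SimpleGraph.backNeighbors]

open Classical in
theorem SimpleGraph.sum_degree_le_of_card_backNeighbors_le {V : Type*} [Fintype V]
    {G : SimpleGraph V} {r : V → ℕ} (hr : Function.Injective r) {k : ℕ}
    (hk : ∀ v, (G.backNeighbors r v).card ≤ k) :
    ∑ v, G.degree v ≤ 2 * k * Fintype.card V := by
  have hsplit : ∀ v, G.degree v ≤ (G.backNeighbors r v).card +
      (Finset.univ.filter fun u ↦ v ∈ G.backNeighbors r u).card := by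
    intro v
    rw [← SimpleGraph.card_neighborFinset_eq_degree]
    refine (Finset.card_le_card ?_).trans (Finset.card_union_le _ _)
    intro u hu
    rw [SimpleGraph.mem_neighborFinset] at hu
    have : r u ≠ r v := fun h ↦ hu.ne (hr h).symm
    rw [Finset.mem_union, Finset.mem_filter, SimpleGraph.mem_backNeighbors,
      SimpleGraph.mem_backNeighbors]
    rcases lt_or_gt_of_ne this with h | h
    · exact Or.inl ⟨hu, h⟩
    · exact Or.inr ⟨Finset.mem_univ _, hu.symm, h⟩
  have hswap : ∑ v, (Finset.univ.filter fun u ↦ v ∈ G.backNeighbors r u).card =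
      ∑ v, (G.backNeighbors r v).card := by
    have := Finset.sum_card_bipartiteAbove_eq_sum_card_bipartiteBelow
      (s := (Finset.univ : Finset V)) (t := Finset.univ) (fun v u ↦ v ∈ G.backNeighbors r u)
    simpa [Finset.bipartiteAbove, Finset.bipartiteBelow] using this
  have hsum : ∑ v, (G.backNeighbors r v).card ≤ Fintype.card V * k := by
    simpa using Finset.sum_le_card_nsmul Finset.univ _ k fun v _ ↦ hk v
  calc ∑ v, G.degree v
      ≤ ∑ v, ((G.backNeighbors r v).card +
        (Finset.univ.filter fun u ↦ v ∈ G.backNeighbors r u).card) :=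
        Finset.sum_le_sum fun v _ ↦ hsplit v
    _ = ∑ v, (G.backNeighbors r v).card + ∑ v, (G.backNeighbors r v).card := by
        rw [Finset.sum_add_distrib, hswap]
    _ ≤ 2 * k * Fintype.card V := by nlinarith

/-- The condition that greedy coloring along the ranking `r` imposes on the color of `v`, where the
vertices of `H` have the reserved colors given by `e`. -/
def GreedyColoredAt {V : Type*} [Fintype V] (G : SimpleGraph V) (r : V → ℕ) (H : Finset V)
    {k b : ℕ} (e : V → Fin b) (f : V → Fin k ⊕ Fin b) (v : V) : Prop :=
  (v ∈ H → f v = Sum.inr (e v)) ∧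
  (v ∉ H →
    (∃ i, f v = Sum.inl i ∧ ∀ u ∈ G.backNeighbors r v, f u ≠ Sum.inl i) ∨
    (∃ j, f v = Sum.inr j ∧ (∀ h ∈ H, e h ≠ j) ∧
      (∀ u ∈ G.backNeighbors r v, ∃ i, f u = Sum.inl i) ∧
      ∀ u w, r u < r v → G.Adj u w → G.Adj w v → f u ≠ Sum.inr j))

section Greedy

variable {V : Type*} [Fintype V] {G : SimpleGraph V} {r : V → ℕ} {H : Finset V} {k b : ℕ}
  {e : V → Fin b} {f : V → Fin k ⊕ Fin b}

theorem GreedyColoredAt.congr {g : V → Fin k ⊕ Fin b} {v : V} (h : GreedyColoredAt G r H e f v)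
    (hfg : ∀ u, r u ≤ r v → g u = f u) : GreedyColoredAt G r H e g v := by
  have hback : ∀ u ∈ G.backNeighbors r v, g u = f u :=
    fun u hu ↦ hfg u (SimpleGraph.mem_backNeighbors.1 hu).2.le
  refine ⟨fun hv ↦ (hfg v le_rfl).trans (h.1 hv), fun hv ↦ ?_⟩
  rcases h.2 hv with ⟨i, hi, hu⟩ | ⟨j, hj, he, hu, hw⟩
  · exact Or.inl ⟨i, (hfg v le_rfl).trans hi, fun u hu' ↦ by rw [hback u hu']; exact hu u hu'⟩
  · exact Or.inr ⟨j, (hfg v le_rfl).trans hj, he,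
      fun u hu' ↦ by rw [hback u hu']; exact hu u hu',
      fun u w hr huw hwv ↦ by rw [hfg u hr.le]; exact hw u w hr huw hwv⟩

open Classical in
theorem GreedyColoredAt.exists_update (hr : Function.Injective r)
    (hk : ∀ v, (G.backNeighbors r v).card ≤ k) {s : ℕ} (hs : ∀ v ∉ H, G.degree v ≤ s)
    (hb : H.card + 2 * k * s < b) (v : V)
    (hf : ∀ u, r u < r v → GreedyColoredAt G r H e f u) :
    ∃ c, GreedyColoredAt G r H e (Function.update f v c) v := by
  have hne : ∀ u, r u < r v → ∀ c, Function.update f v c u = f u :=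
    fun u hu c ↦ Function.update_of_ne (fun h ↦ hu.ne (congrArg r h)) _ _
  have hback : ∀ u ∈ G.backNeighbors r v, ∀ c, Function.update f v c u = f u :=
    fun u hu ↦ hne u (SimpleGraph.mem_backNeighbors.1 hu).2
  by_cases hv : v ∈ H
  · exact ⟨Sum.inr (e v), fun _ ↦ Function.update_self .., fun h ↦ absurd hv h⟩
  by_cases hfree : ∃ i : Fin k, ∀ u ∈ G.backNeighbors r v, f u ≠ Sum.inl i
  · obtain ⟨i, hi⟩ := hfree
    refine ⟨Sum.inl i, fun h ↦ absurd h hv, fun _ ↦ Or.inl ⟨i, Function.update_self .., ?_⟩⟩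
    intro u hu
    rw [hback u hu]
    exact hi u hu
  push Not at hfree
  have himage : Finset.univ.image (Sum.inl : Fin k → Fin k ⊕ Fin b) =
      (G.backNeighbors r v).image f := by
    refine Finset.eq_of_subset_of_card_le ?_ ?_
    · intro c hc
      obtain ⟨i, -, rfl⟩ := Finset.mem_image.1 hc
      obtain ⟨u, hu, hui⟩ := hfree i
      exact Finset.mem_image.2 ⟨u, hu, hui⟩
    · rw [Finset.card_image_of_injective _ Sum.inl_injective, Finset.card_fin]
      exact Finset.card_image_le.trans (hk v)
  have hinl : ∀ u ∈ G.backNeighbors r v, ∃ i, f u = Sum.inl i := by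
    intro u hu
    have := Finset.mem_image_of_mem f hu
    rw [← himage] at this
    obtain ⟨i, -, hi⟩ := Finset.mem_image.1 this
    exact ⟨i, hi.symm⟩
  have hlow : ∀ u ∈ G.backNeighbors r v, u ∉ H := by
    intro u hu huH
    obtain ⟨i, hi⟩ := hinl u hu
    have := (hf u (SimpleGraph.mem_backNeighbors.1 hu).2).1 huH
    simp [hi] at this
  let T : Finset V := ((G.backNeighbors r v).biUnion fun w ↦ G.neighborFinset w) ∪
    ((G.neighborFinset v).biUnion fun w ↦ G.backNeighbors r w)
  have hT : T.card ≤ 2 * k * s := by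
    have h1 : ((G.backNeighbors r v).biUnion fun w ↦ G.neighborFinset w).card ≤ k * s := by
      refine (Finset.card_biUnion_le_card_mul _ _ s fun w hw ↦ ?_).trans
        (Nat.mul_le_mul_right _ (hk v))
      rw [SimpleGraph.card_neighborFinset_eq_degree]
      exact hs w (hlow w hw)
    have h2 : ((G.neighborFinset v).biUnion fun w ↦ G.backNeighbors r w).card ≤ s * k := by
      refine (Finset.card_biUnion_le_card_mul _ _ k fun w _ ↦ hk w).trans
        (Nat.mul_le_mul_right _ ?_)
      rw [SimpleGraph.card_neighborFinset_eq_degree]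
      exact hs v hv
    refine (Finset.card_union_le _ _).trans ((add_le_add h1 h2).trans (le_of_eq ?_))
    ring
  obtain ⟨j, hj⟩ : ∃ j : Fin b,
      (Sum.inr j : Fin k ⊕ Fin b) ∉ H.image (fun h ↦ Sum.inr (e h)) ∪ T.image f := by
    by_contra! hall
    have hsub : Finset.univ.image (Sum.inr : Fin b → Fin k ⊕ Fin b) ⊆
        H.image (fun h ↦ Sum.inr (e h)) ∪ T.image f := by
      intro c hc
      obtain ⟨j, -, rfl⟩ := Finset.mem_image.1 hc
      exact hall j
    have hcard := (Finset.card_le_card hsub).trans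
      ((Finset.card_union_le _ _).trans (add_le_add Finset.card_image_le Finset.card_image_le))
    rw [Finset.card_image_of_injective _ Sum.inr_injective, Finset.card_fin] at hcard
    omega
  rw [Finset.mem_union, not_or] at hj
  refine ⟨Sum.inr j, fun h ↦ absurd h hv, fun _ ↦ Or.inr ⟨j, Function.update_self .., ?_, ?_, ?_⟩⟩
  · rintro h hh rfl
    exact hj.1 (Finset.mem_image_of_mem _ hh)
  · intro u hu
    rw [hback u hu]
    exact hinl u hu
  · intro u w hu huw hwv hfu
    rw [hne u hu] at hfu
    refine hj.2 (hfu ▸ Finset.mem_image_of_mem f (Finset.mem_union.2 ?_))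
    rcases lt_or_gt_of_ne (fun h ↦ hwv.ne (hr h) : r w ≠ r v) with h | h
    · exact Or.inl (Finset.mem_biUnion.2 ⟨w, SimpleGraph.mem_backNeighbors.2 ⟨hwv.symm, h⟩,
        (G.mem_neighborFinset _ _).2 huw.symm⟩)
    · exact Or.inr (Finset.mem_biUnion.2 ⟨w, (G.mem_neighborFinset _ _).2 hwv.symm,
        SimpleGraph.mem_backNeighbors.2 ⟨huw.symm, hu.trans h⟩⟩)

open Classical in
theorem exists_greedyColoredAt (hr : Function.Injective r)
    (hk : ∀ v, (G.backNeighbors r v).card ≤ k) {s : ℕ} (hs : ∀ v ∉ H, G.degree v ≤ s)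
    (hb : H.card + 2 * k * s < b) (e : V → Fin b) :
    ∃ f : V → Fin k ⊕ Fin b, ∀ v, GreedyColoredAt G r H e f v := by
  suffices h : ∀ m, ∃ f : V → Fin k ⊕ Fin b, ∀ v, r v < m → GreedyColoredAt G r H e f v by
    obtain ⟨f, hf⟩ := h (Finset.univ.sup r + 1)
    exact ⟨f, fun v ↦ hf v (Nat.lt_succ_of_le (Finset.le_sup (f := r) (Finset.mem_univ v)))⟩
  intro m
  induction m with
  | zero => exact ⟨fun v ↦ Sum.inr (e v), fun v hv ↦ absurd hv (Nat.not_lt_zero _)⟩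
  | succ m ih =>
    obtain ⟨f, hf⟩ := ih
    by_cases hm : ∃ v, r v = m
    · obtain ⟨v, rfl⟩ := hm
      obtain ⟨c, hc⟩ := GreedyColoredAt.exists_update hr hk hs hb v hf
      refine ⟨Function.update f v c, fun u hu ↦ ?_⟩
      rcases (Nat.lt_succ_iff.1 hu).lt_or_eq with h | h
      · exact (hf u h).congr fun w hw ↦
          Function.update_of_ne (fun hwv ↦ (hw.trans_lt h).ne (congrArg r hwv)) _ _
      · rwa [hr h]
    · refine ⟨f, fun u hu ↦ hf u ?_⟩
      exact lt_of_le_of_ne (Nat.lt_succ_iff.1 hu) fun h ↦ hm ⟨u, h⟩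

theorem ABColorable.of_greedyColoredAt (hr : Function.Injective r)
    (he : Set.InjOn e H) (hf : ∀ v, GreedyColoredAt G r H e f v) : ABColorable G k b := by
  have hindep : ∀ i u v, f u = Sum.inl i → f v = Sum.inl i → r u < r v → ¬ G.Adj v u := by
    intro i u v hu hv huv hadj
    have hvH : v ∉ H := fun h ↦ by simpa [hv] using (hf v).1 h
    rcases (hf v).2 hvH with ⟨i', hi', h⟩ | ⟨j, hj, -⟩
    · obtain rfl : i = i' := Sum.inl_injective (hv.symm.trans hi')
      exact h u (SimpleGraph.mem_backNeighbors.2 ⟨hadj, huv⟩) hu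
    · simp [hv] at hj
  have htwo : ∀ j u v, f u = Sum.inr j → f v = Sum.inr j → r u < r v →
      ¬ G.Adj u v ∧ ∀ w, ¬ (G.Adj u w ∧ G.Adj w v) := by
    intro j u v hu hv huv
    by_cases hvH : v ∈ H
    · exfalso
      have hev : e v = j := Sum.inr_injective (((hf v).1 hvH).symm.trans hv)
      by_cases huH : u ∈ H
      · have heu : e u = j := Sum.inr_injective (((hf u).1 huH).symm.trans hu)
        exact huv.ne (congrArg r (he huH hvH (heu.trans hev.symm)))
      · rcases (hf u).2 huH with ⟨i, hi, -⟩ | ⟨j', hj', h, -⟩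
        · simp [hu] at hi
        · obtain rfl : j = j' := Sum.inr_injective (hu.symm.trans hj')
          exact h v hvH hev
    · rcases (hf v).2 hvH with ⟨i, hi, -⟩ | ⟨j', hj', -, hback, h⟩
      · simp [hv] at hi
      obtain rfl : j = j' := Sum.inr_injective (hv.symm.trans hj')
      refine ⟨fun hadj ↦ ?_, fun w hw ↦ h u w huv hw.1 hw.2 hu⟩
      obtain ⟨i, hi⟩ := hback u (SimpleGraph.mem_backNeighbors.2 ⟨hadj.symm, huv⟩)
      simp [hu] at hi
  refine ⟨f, fun i u hu v hv hadj ↦ ?_, fun j u hu v hv huv ↦ ?_⟩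
  · rcases lt_or_gt_of_ne (fun h ↦ hadj.ne (hr h) : r u ≠ r v) with h | h
    · exact hindep i u v hu hv h hadj.symm
    · exact hindep i v u hv hu h hadj
  · rcases lt_or_gt_of_ne (fun h ↦ huv (hr h) : r u ≠ r v) with h | h
    · exact htwo j u v hu hv h
    · obtain ⟨h1, h2⟩ := htwo j v u hv hu h
      exact ⟨fun h' ↦ h1 h'.symm, fun w hw ↦ h2 w ⟨hw.2.symm, hw.1.symm⟩⟩

end Greedy

theorem ABColorable.of_card_le {V : Type*} [Fintype V] (G : SimpleGraph V) {a b : ℕ}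
    (h : Fintype.card V ≤ b) : ABColorable G a b := by
  obtain ⟨e⟩ : Nonempty (V ↪ Fin b) :=
    Function.Embedding.nonempty_of_card_le (by simpa using h)
  refine ⟨fun v ↦ Sum.inr (e v), fun i u hu ↦ by simp at hu, fun j u hu v hv huv ↦ ?_⟩
  exact absurd (e.injective (Sum.inr_injective (hu.trans hv.symm))) huv

theorem KDegenerate.abColorable {V : Type*} [Fintype V] {G : SimpleGraph V} {k : ℕ} (hk : 1 ≤ k)
    (hdeg : KDegenerate G k) {b : ℕ} (hb : 4 * k * (Fintype.card V).sqrt + 2 * k ≤ b) :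
    ABColorable G k b := by
  classical
  obtain ⟨r, hr, hrk⟩ := hdeg.exists_ranking
  have hback : ∀ v, (G.backNeighbors r v).card ≤ k := by
    intro v
    rw [← Set.ncard_coe_finset]
    simpa [SimpleGraph.backNeighbors] using hrk v
  set s := (Fintype.card V).sqrt with hs
  let H : Finset V := {v | s + 1 ≤ G.degree v}
  have hH : H.card < 2 * k * (s + 1) := by
    have hsum : H.card * (s + 1) ≤ 2 * k * Fintype.card V := by
      refine le_trans ?_ (SimpleGraph.sum_degree_le_of_card_backNeighbors_le hr hback)
      refine le_trans ?_ (Finset.sum_le_sum_of_subset (Finset.subset_univ H))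
      simpa using Finset.card_nsmul_le_sum H (fun v ↦ G.degree v) (s + 1)
        fun v hv ↦ (Finset.mem_filter.1 hv).2
    have hlt : Fintype.card V < (s + 1) * (s + 1) := Nat.lt_succ_sqrt _
    have : 2 * k * Fintype.card V < 2 * k * ((s + 1) * (s + 1)) :=
      Nat.mul_lt_mul_of_pos_left hlt (by omega)
    refine Nat.lt_of_mul_lt_mul_right (a := s + 1) (hsum.trans_lt ?_)
    rwa [mul_assoc (2 * k)]
  have hHb : H.card + 2 * k * s < b := by nlinarith
  obtain ⟨e⟩ : Nonempty (H ↪ Fin b) :=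
    Function.Embedding.nonempty_of_card_le (by simp; omega)
  have hb0 : 0 < b := by omega
  let e' : V → Fin b := fun v ↦ if h : v ∈ H then e ⟨v, h⟩ else ⟨0, hb0⟩
  have he' : Set.InjOn e' H := by
    intro x hx y hy hxy
    rw [Finset.mem_coe] at hx hy
    simp only [e', hx, hy, dif_pos] at hxy
    exact congrArg Subtype.val (e.injective hxy)
  have hlow : ∀ v ∉ H, G.degree v ≤ s := fun v hv ↦ by
    simpa [H, Nat.lt_succ_iff] using hv
  obtain ⟨f, hf⟩ := exists_greedyColoredAt hr hback hlow hHb e'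
  exact ABColorable.of_greedyColoredAt hr he' hf

theorem stmt_0 {V : Type*} [Fintype V] (k : ℕ) (hk : 1 ≤ k) (G : SimpleGraph V)
    (hdeg : KDegenerate G k) (b : ℕ)
    (hb : 4 * (k : ℝ) * Real.sqrt ((k : ℝ) + 1) * Real.sqrt (Fintype.card V) ≤ (b : ℝ)) :
    ABColorable G k b := by
  have hsq : 32 * k ^ 2 * Fintype.card V ≤ b ^ 2 := by
    have h := pow_le_pow_left₀ (by positivity) hb 2
    rw [mul_pow, mul_pow, mul_pow, Real.sq_sqrt (by positivity), Real.sq_sqrt (by positivity)] at h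
    have h' : 4 ^ 2 * k ^ 2 * (k + 1) * Fintype.card V ≤ b ^ 2 := by exact_mod_cast h
    refine le_trans (Nat.mul_le_mul_right _ ?_) h'
    nlinarith [Nat.zero_le (k ^ 2)]
  rcases le_or_gt (Fintype.card V) b with hcard | hcard
  · exact ABColorable.of_card_le G hcard
  refine hdeg.abColorable hk ?_
  have hbig : 4 ≤ Fintype.card V := by
    by_contra! hlt
    have : 32 * Fintype.card V ≤ b ^ 2 :=
      le_trans (Nat.mul_le_mul_right _ (by nlinarith)) hsq
    nlinarith
  have hs2 : 2 ≤ (Fintype.card V).sqrt := Nat.le_sqrt.2 hbig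
  have hs : (Fintype.card V).sqrt ^ 2 ≤ Fintype.card V := Nat.sqrt_le' _
  generalize (Fintype.card V).sqrt = s at hs hs2
  refine (Nat.pow_le_pow_iff_left two_ne_zero).1 (le_trans ?_ hsq)
  calc (4 * k * s + 2 * k) ^ 2 = k ^ 2 * (4 * s + 2) ^ 2 := by ring
    _ ≤ k ^ 2 * (32 * s ^ 2) := Nat.mul_le_mul_left _ (by nlinarith)
    _ ≤ k ^ 2 * (32 * Fintype.card V) := by gcongr
    _ = 32 * k ^ 2 * Fintype.card V := by ring
end

section
/- Let k ≥ 1 be an integer, let G be a k-degenerate finite simple graph, and let S be a dominating set of G with |S| = N. Then there exists a set T of vertices of G with S ⊆ T and |T| ≤ (k+1)·N such that the subgraph of G induced on the complement of T admits a proper vertex coloring with k colors. -/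
/-- A set `S` of vertices is dominating if every vertex outside `S` is adjacent to
some vertex of `S`. -/
def DominatingSet {V : Type*} (G : SimpleGraph V) (S : Set V) : Prop :=
  ∀ v : V, v ∉ S → ∃ u ∈ S, G.Adj u v

open Classical in
/-- Peel off vertices with few neighbors one at a time: `P` collects the neighbors of the vertices
of `S` that are still present when these are peeled off, and `c` greedily colors the vertices
outside `S ∪ P` having a neighbor in `S ∩ A`. -/
theorem KDegenerate.exists_coloring_of_finset {V : Type*} {k : ℕ} (hk : 1 ≤ k)
    {G : SimpleGraph V} (hdeg : KDegenerate G k) (S A : Finset V) :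
    ∃ (P : Finset V) (c : V → Fin k), P.card ≤ k * (S ∩ A).card ∧
      ∀ x ∈ A, ∀ y ∈ A, x ∉ S → y ∉ S → x ∉ P → y ∉ P →
        (∃ u ∈ S ∩ A, G.Adj x u) → (∃ u ∈ S ∩ A, G.Adj y u) → G.Adj x y → c x ≠ c y := by
  induction A using Finset.strongInduction with
  | H A ih =>
    rcases A.eq_empty_or_nonempty with rfl | hA
    · exact ⟨∅, fun _ => ⟨0, hk⟩, by simp, by simp⟩
    obtain ⟨v, hv, hcard⟩ := hdeg (A : Set V) (by exact_mod_cast hA)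
    have hvA : v ∈ A := by exact_mod_cast hv
    have hnb : (A.filter (G.Adj v)).card ≤ k := by
      rw [← Set.ncard_coe_finset]
      simpa using hcard
    obtain ⟨P, c, hP, hc⟩ := ih (A.erase v) (Finset.erase_ssubset hvA)
    by_cases hvS : v ∈ S
    · refine ⟨P ∪ A.filter (G.Adj v), c, ?_, ?_⟩
      · have hcount : (S ∩ A.erase v).card + 1 = (S ∩ A).card := by
          rw [Finset.inter_erase]
          exact Finset.card_erase_add_one (Finset.mem_inter.2 ⟨hvS, hvA⟩)
        rw [← hcount, mul_add, mul_one]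
        exact (Finset.card_union_le _ _).trans (add_le_add hP hnb)
      · intro x hx y hy hxS hyS hxP hyP hxu hyu hxy
        have key : ∀ z ∈ A, z ∉ P ∪ A.filter (G.Adj v) → (∃ u ∈ S ∩ A, G.Adj z u) →
            ∃ u ∈ S ∩ A.erase v, G.Adj z u := by
          rintro z hz hzP ⟨u, hu, hzu⟩
          have huv : u ≠ v := by
            rintro rfl
            exact hzP (Finset.mem_union_right _ (Finset.mem_filter.2 ⟨hz, hzu.symm⟩))
          refine ⟨u, ?_, hzu⟩
          simp only [Finset.mem_inter, Finset.mem_erase] at hu ⊢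
          exact ⟨hu.1, huv, hu.2⟩
        refine hc x (Finset.mem_erase.2 ⟨?_, hx⟩) y (Finset.mem_erase.2 ⟨?_, hy⟩) hxS hyS
          (fun h => hxP (Finset.mem_union_left _ h)) (fun h => hyP (Finset.mem_union_left _ h))
          (key x hx hxP hxu) (key y hy hyP hyu) hxy
        · rintro rfl
          exact hxS hvS
        · rintro rfl
          exact hyS hvS
    · have hSA : S ∩ A.erase v = S ∩ A := by
        rw [Finset.inter_erase, Finset.erase_eq_of_notMem (fun h => hvS (Finset.mem_inter.1 h).1)]
      rw [hSA] at hP hc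
      by_cases hu : ∃ u ∈ S ∩ A, G.Adj v u
      · obtain ⟨u, hu, hvu⟩ := hu
        rw [Finset.mem_inter] at hu
        have hlt : ((A.filter (G.Adj v)).filter (· ∉ S)).card < k := by
          refine lt_of_lt_of_le (Finset.card_lt_card ?_) hnb
          exact Finset.filter_ssubset.2 ⟨u, Finset.mem_filter.2 ⟨hu.2, hvu⟩, not_not.2 hu.1⟩
        obtain ⟨a, ha⟩ : ∃ a : Fin k, a ∉ ((A.filter (G.Adj v)).filter (· ∉ S)).image c := by
          by_contra! h
          have hle := Finset.card_le_card (fun a _ => h a : (Finset.univ : Finset (Fin k)) ⊆ _)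
          rw [Finset.card_univ, Fintype.card_fin] at hle
          exact absurd (hle.trans Finset.card_image_le) (not_le.2 hlt)
        have hcol : ∀ z ∈ A, z ∉ S → G.Adj v z → c z ≠ a := by
          rintro z hz hzS hvz rfl
          exact ha (Finset.mem_image_of_mem c (by simp [hz, hzS, hvz]))
        refine ⟨P, Function.update c v a, hP, ?_⟩
        intro x hx y hy hxS hyS hxP hyP hxu hyu hxy
        by_cases hxv : x = v
        · subst hxv
          rw [Function.update_self, Function.update_of_ne hxy.ne']
          exact (hcol y hy hyS hxy).symm
        by_cases hyv : y = v
        · subst hyv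
          rw [Function.update_self, Function.update_of_ne hxv]
          exact hcol x hx hxS hxy.symm
        rw [Function.update_of_ne hxv, Function.update_of_ne hyv]
        exact hc x (Finset.mem_erase.2 ⟨hxv, hx⟩) y (Finset.mem_erase.2 ⟨hyv, hy⟩)
          hxS hyS hxP hyP hxu hyu hxy
      · refine ⟨P, c, hP, ?_⟩
        intro x hx y hy hxS hyS hxP hyP hxu hyu hxy
        refine hc x (Finset.mem_erase.2 ⟨?_, hx⟩) y (Finset.mem_erase.2 ⟨?_, hy⟩)
          hxS hyS hxP hyP hxu hyu hxy
        · rintro rfl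
          exact hu hxu
        · rintro rfl
          exact hu hyu

theorem stmt_1 {V : Type*} [Fintype V] (k : ℕ) (hk : 1 ≤ k) (G : SimpleGraph V)
    (hdeg : KDegenerate G k) (S : Set V) (hS : DominatingSet G S) (N : ℕ)
    (hN : S.ncard = N) :
    ∃ T : Set V, S ⊆ T ∧ T.ncard ≤ (k + 1) * N ∧
      (G.induce (Tᶜ : Set V)).Colorable k := by
  classical
  obtain ⟨P, c, hP, hc⟩ := hdeg.exists_coloring_of_finset hk S.toFinset Finset.univ
  rw [Finset.inter_univ, ← Set.ncard_eq_toFinset_card', hN] at hP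
  refine ⟨S ∪ P, Set.subset_union_left, ?_, ?_⟩
  · have hle := Set.ncard_union_le S (P : Set V)
    rw [hN, Set.ncard_coe_finset] at hle
    linarith
  · refine ⟨SimpleGraph.Coloring.mk (fun x => c x) ?_⟩
    rintro ⟨x, hx⟩ ⟨y, hy⟩ hxy
    simp only [Set.mem_compl_iff, Set.mem_union, Finset.mem_coe, not_or] at hx hy
    obtain ⟨u, hu, hux⟩ := hS x hx.1
    obtain ⟨w, hw, hwy⟩ := hS y hy.1
    exact hc x (Finset.mem_univ x) y (Finset.mem_univ y) (by simpa using hx.1)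
      (by simpa using hy.1) hx.2 hy.2 ⟨u, by simpa using hu, hux.symm⟩
      ⟨w, by simpa using hw, hwy.symm⟩ hxy
end

section
/- Let k ≥ 1 be an integer, let G be a k-degenerate finite simple graph, and let S be a dominating set of G with |S| = N. Then the vertex set of G can be partitioned into k independent sets together with a set T of at most (k+1)·N further vertices; in particular, G is (k,(k+1)·N)-colorable by a coloring in which every 2-independent color class is a singleton. -/
open Classical in
/-- Build up a `k`-degenerate graph vertex by vertex: on each finite vertex set `A` there are a
small set `T ⊇ S ∩ A` and a `k`-coloring that is proper on the vertices of `A \ T` already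
dominated by `S ∩ A`. -/
theorem KDegenerate.exists_coloring_dominated {V : Type*} {G : SimpleGraph V}
    {k : ℕ} (hk : 1 ≤ k) (hdeg : KDegenerate G k) (S A : Finset V) :
    ∃ (T : Finset V) (c : V → Fin k), S ∩ A ⊆ T ∧ T.card ≤ (k + 1) * (S ∩ A).card ∧
      ∀ u ∈ A, ∀ w ∈ A, u ∉ T → w ∉ T → (∃ s ∈ S ∩ A, G.Adj u s) →
        (∃ s ∈ S ∩ A, G.Adj w s) → G.Adj u w → c u ≠ c w := by
  induction hn : A.card generalizing A with
  | zero =>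
    obtain rfl := Finset.card_eq_zero.mp hn
    exact ⟨∅, fun _ => ⟨0, hk⟩, by simp⟩
  | succ n ih =>
    obtain ⟨v, hvA, hv⟩ := hdeg A (by
      rw [Finset.coe_nonempty, ← Finset.card_pos]; omega)
    replace hvA : v ∈ A := hvA
    set B := A.filter (fun u => G.Adj v u) with hB
    have hBk : B.card ≤ k := by
      rw [← Set.ncard_coe_finset]
      simpa [hB] using hv
    obtain ⟨T, c, hST, hT, hc⟩ := ih (A.erase v) (by rw [Finset.card_erase_of_mem hvA, hn]; rfl)
    by_cases hvS : v ∈ S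
    · have hSA : S ∩ A = insert v (S ∩ A.erase v) := by
        ext x; simp only [Finset.mem_inter, Finset.mem_insert, Finset.mem_erase]; grind
      have hcard : (S ∩ A).card = (S ∩ A.erase v).card + 1 := by
        rw [hSA, Finset.card_insert_of_notMem (by simp)]
      refine ⟨T ∪ insert v B, c, ?_, ?_, ?_⟩
      · rw [hSA]; intro x; have := @hST x; grind
      · have h₁ := Finset.card_union_le T (insert v B)
        have h₂ := Finset.card_insert_le v B
        rw [hcard, mul_add]; omega
      · have key : ∀ u ∈ A, u ∉ T ∪ insert v B → (∃ s ∈ S ∩ A, G.Adj u s) →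
            u ∈ A.erase v ∧ u ∉ T ∧ ∃ s ∈ S ∩ A.erase v, G.Adj u s := by
          rintro u hu huT ⟨s, hs, hus⟩
          simp only [Finset.mem_union, Finset.mem_insert, not_or] at huT
          refine ⟨Finset.mem_erase.mpr ⟨huT.2.1, hu⟩, huT.1, s, ?_, hus⟩
          have hsv : s ≠ v := by
            rintro rfl
            exact huT.2.2 (Finset.mem_filter.mpr ⟨hu, hus.symm⟩)
          grind
        intro u hu w hw huT hwT hus hws
        obtain ⟨hu', huT', hus'⟩ := key u hu huT hus
        obtain ⟨hw', hwT', hws'⟩ := key w hw hwT hws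
        exact hc u hu' w hw' huT' hwT' hus' hws'
    · have hSA : S ∩ A = S ∩ A.erase v := by
        ext x; simp only [Finset.mem_inter, Finset.mem_erase]; grind
      rw [← hSA] at hST hT hc
      by_cases hvs : ∃ s ∈ S ∩ A, G.Adj v s
      · obtain ⟨s, hs, hvs⟩ := hvs
        have hsB : s ∈ B := Finset.mem_filter.mpr ⟨(Finset.mem_inter.mp hs).2, hvs⟩
        obtain ⟨a, ha⟩ : ∃ a, a ∉ (B.erase s).image c := by
          by_contra! h
          have h₁ : (Finset.univ : Finset (Fin k)).card ≤ ((B.erase s).image c).card :=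
            Finset.card_le_card fun a _ => h a
          have h₂ := Finset.card_image_le (s := B.erase s) (f := c)
          have h₃ := Finset.card_pos.mpr ⟨s, hsB⟩
          rw [Finset.card_erase_of_mem hsB] at h₂
          rw [Finset.card_univ, Fintype.card_fin] at h₁
          omega
        have hne : ∀ w ∈ A, w ∉ T → G.Adj v w → c w ≠ a := by
          intro w hw hwT hvw h
          refine ha (Finset.mem_image.mpr ⟨w, Finset.mem_erase.mpr ⟨?_, ?_⟩, h⟩)
          · rintro rfl; exact hwT (hST hs)
          · exact Finset.mem_filter.mpr ⟨hw, hvw⟩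
        refine ⟨T, Function.update c v a, hST, hT, ?_⟩
        intro u hu w hw huT hwT hus hws huw
        by_cases huv : u = v
        · subst huv
          rw [Function.update_self, Function.update_of_ne huw.ne']
          exact (hne w hw hwT huw).symm
        by_cases hwv : w = v
        · subst hwv
          rw [Function.update_self, Function.update_of_ne huv]
          exact hne u hu huT huw.symm
        rw [Function.update_of_ne huv, Function.update_of_ne hwv]
        exact hc u (Finset.mem_erase.mpr ⟨huv, hu⟩) w (Finset.mem_erase.mpr ⟨hwv, hw⟩)
          huT hwT hus hws huw
      · refine ⟨T, c, hST, hT, ?_⟩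
        intro u hu w hw huT hwT hus hws
        have huv : u ≠ v := by rintro rfl; exact hvs hus
        have hwv : w ≠ v := by rintro rfl; exact hvs hws
        exact hc u (Finset.mem_erase.mpr ⟨huv, hu⟩) w (Finset.mem_erase.mpr ⟨hwv, hw⟩)
          huT hwT hus hws

theorem stmt_2 {V : Type*} [Fintype V] (k : ℕ) (hk : 1 ≤ k) (G : SimpleGraph V)
    (hdeg : KDegenerate G k) (S : Set V) (hS : DominatingSet G S) (N : ℕ)
    (hN : S.ncard = N) :
    ∃ f : V → Fin k ⊕ Fin ((k + 1) * N),
      (∀ i : Fin k, IndepOn G {v | f v = Sum.inl i}) ∧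
      (∀ j : Fin ((k + 1) * N),
        TwoIndepOn G {v | f v = Sum.inr j} ∧ {v | f v = Sum.inr j}.Subsingleton) := by
  classical
  obtain ⟨T, c, hST, hT, hc⟩ :=
    hdeg.exists_coloring_dominated hk S.toFinset Finset.univ
  rw [Finset.inter_univ] at hST hT hc
  rw [← Set.ncard_eq_toFinset_card', hN] at hT
  obtain ⟨e⟩ : Nonempty (T ↪ Fin ((k + 1) * N)) :=
    Function.Embedding.nonempty_of_card_le (by simpa using hT)
  have hdom : ∀ v, v ∉ T → ∃ s ∈ S.toFinset, G.Adj v s := by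
    intro v hv
    obtain ⟨s, hs, hsv⟩ := hS v fun h => hv (hST (Set.mem_toFinset.mpr h))
    exact ⟨s, Set.mem_toFinset.mpr hs, hsv.symm⟩
  refine ⟨fun v => if h : v ∈ T then Sum.inr (e ⟨v, h⟩) else Sum.inl (c v), ?_, ?_⟩
  · intro i u hu v hv huv
    by_cases huT : u ∈ T
    · simp [huT] at hu
    by_cases hvT : v ∈ T
    · simp [hvT] at hv
    simp only [Set.mem_ofPred_eq, huT, hvT, dite_false, Sum.inl.injEq] at hu hv
    exact hc u (Finset.mem_univ u) v (Finset.mem_univ v) huT hvT (hdom u huT) (hdom v hvT) huv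
      (hu.trans hv.symm)
  · intro j
    have hsub : {v | (if h : v ∈ T then Sum.inr (e ⟨v, h⟩) else Sum.inl (c v) :
        Fin k ⊕ Fin ((k + 1) * N)) = Sum.inr j}.Subsingleton := by
      intro u hu v hv
      by_cases huT : u ∈ T
      · by_cases hvT : v ∈ T
        · simp only [Set.mem_ofPred_eq, huT, hvT, dite_true, Sum.inr.injEq] at hu hv
          exact congrArg Subtype.val (e.injective (hu.trans hv.symm))
        · simp [hvT] at hv
      · simp [huT] at hu
    exact ⟨fun u hu v hv huv => absurd (hsub hu hv) huv, hsub⟩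
end

section
/- For all integers k ≥ 1 and l ≥ 1, there exists a k-degenerate finite simple graph of order k·l² + (2k+1)·l + k + 2 that is not (k,l)-colorable. -/
theorem KDegenerate.of_iso {V W : Type*} {G : SimpleGraph V} {H : SimpleGraph W} {k : ℕ}
    (e : H ≃g G) (h : KDegenerate G k) : KDegenerate H k := by
  intro A hA
  obtain ⟨_, ⟨x, hx, rfl⟩, hcard⟩ := h (e '' A) (hA.image e)
  refine ⟨x, hx, ?_⟩
  have himage : {u ∈ e '' A | G.Adj (e x) u} = e '' {u ∈ A | H.Adj x u} := by
    ext u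
    constructor
    · rintro ⟨⟨y, hy, rfl⟩, hadj⟩
      exact ⟨y, ⟨hy, e.map_adj_iff.1 hadj⟩, rfl⟩
    · rintro ⟨y, ⟨hy, hadj⟩, rfl⟩
      exact ⟨⟨y, hy, rfl⟩, e.map_adj_iff.2 hadj⟩
  rwa [himage, Set.ncard_image_of_injective _ e.injective] at hcard

theorem ABColorable.of_iso {V W : Type*} {G : SimpleGraph V} {H : SimpleGraph W} {a b : ℕ}
    (e : G ≃g H) (h : ABColorable H a b) : ABColorable G a b := by
  obtain ⟨f, hf, hf'⟩ := h
  refine ⟨f ∘ e, fun i u hu v hv hadj => hf i hu hv (e.map_adj_iff.2 hadj),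
    fun j u hu v hv hne => ?_⟩
  obtain ⟨h₁, h₂⟩ := hf' j hu hv (e.injective.ne hne)
  exact ⟨fun hadj => h₁ (e.map_adj_iff.2 hadj),
    fun w hw => h₂ (e w) ⟨e.map_adj_iff.2 hw.1, e.map_adj_iff.2 hw.2⟩⟩

/-- Among more than `b` neighbors of a vertex, some neighbor is not in any of `b` given
2-independent sets. -/
theorem exists_inl_of_neighbors {V ι : Type*} [Fintype ι] {G : SimpleGraph V} {a b : ℕ}
    {f : V → Fin a ⊕ Fin b} (hf : ∀ j : Fin b, TwoIndepOn G {v | f v = Sum.inr j})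
    (hι : b < Fintype.card ι) (w : V) (g : ι → V) (hg : Function.Injective g)
    (hadj : ∀ i, G.Adj w (g i)) : ∃ i c, f (g i) = Sum.inl c := by
  by_contra! hne
  have hinr : ∀ i, ∃ c, f (g i) = Sum.inr c := fun i => by
    cases h : f (g i) with
    | inl c => exact absurd h (hne i c)
    | inr c => exact ⟨c, rfl⟩
  choose c hc using hinr
  obtain ⟨i, j, hij, hcij⟩ := Fintype.exists_ne_map_eq_of_card_lt c (by simpa using hι)
  exact (hf (c i) (hc i) (hcij ▸ hc j) (hg.ne hij)).2 w ⟨(hadj i).symm, hadj j⟩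

/-- A clique with more than `a` vertices is not covered by `a` independent sets. -/
theorem exists_inr_of_clique {V ι : Type*} [Fintype ι] {G : SimpleGraph V} {a b : ℕ}
    {f : V → Fin a ⊕ Fin b} (hf : ∀ i : Fin a, IndepOn G {v | f v = Sum.inl i})
    (hι : a < Fintype.card ι) (g : ι → V) (hadj : ∀ i j, i ≠ j → G.Adj (g i) (g j)) :
    ∃ i c, f (g i) = Sum.inr c := by
  by_contra! hne
  have hinl : ∀ i, ∃ c, f (g i) = Sum.inl c := fun i => by
    cases h : f (g i) with
    | inl c => exact ⟨c, rfl⟩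
    | inr c => exact absurd h (hne i c)
  choose c hc using hinl
  obtain ⟨i, j, hij, hcij⟩ := Fintype.exists_ne_map_eq_of_card_lt c (by simpa using hι)
  exact hf (c i) (hc i) (hcij ▸ hc j) (hadj i j hij)

/-- The vertices of `cliqueTree`: a root `none`, hubs `some (i, none)`, and clique vertices
`some (i, some (j, a))`. -/
abbrev CliqueTreeVertex (I J K : Type*) : Type _ := Option (I × Option (J × K))

/-- The root is joined to one hub for each `i : I`, and the hub `i` is joined to all vertices of
a family indexed by `J` of disjoint cliques on `K`. -/
def cliqueTree (I J K : Type*) : SimpleGraph (CliqueTreeVertex I J K) where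
  Adj
    | none, some (_, none) => True
    | some (_, none), none => True
    | some (i, none), some (i', some _) => i = i'
    | some (i, some _), some (i', none) => i = i'
    | some (i, some (j, a)), some (i', some (j', a')) => i = i' ∧ j = j' ∧ a ≠ a'
    | _, _ => False
  symm := ⟨by
    rintro (_ | ⟨i, _ | ⟨j, a⟩⟩) (_ | ⟨i', _ | ⟨j', a'⟩⟩) h <;> grind⟩
  loopless := ⟨by
    rintro (_ | ⟨i, _ | ⟨j, a⟩⟩) h <;> grind⟩

theorem cliqueTree_kDegenerate (I J : Type*) {k : ℕ} (hk : 1 ≤ k) :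
    KDegenerate (cliqueTree I J (Fin k)) k := by
  intro A hA
  by_cases hclique : ∃ i j a, some (i, some (j, a)) ∈ A
  · obtain ⟨i, j, a, hmem⟩ := hclique
    refine ⟨_, hmem, ?_⟩
    let g : Fin k → CliqueTreeVertex I J (Fin k) :=
      fun b => if b = a then some (i, none) else some (i, some (j, b))
    have hsub : {u ∈ A | (cliqueTree I J (Fin k)).Adj (some (i, some (j, a))) u} ⊆
        g '' Set.univ := by
      rintro (_ | ⟨i', _ | ⟨j', a'⟩⟩) ⟨-, hadj⟩
      · exact hadj.elim
      · obtain rfl : i = i' := hadj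
        exact ⟨a, trivial, if_pos rfl⟩
      · obtain ⟨rfl, rfl, hne⟩ : i = i' ∧ j = j' ∧ a ≠ a' := hadj
        exact ⟨a', trivial, if_neg hne.symm⟩
    calc _ ≤ (g '' Set.univ).ncard := Set.ncard_le_ncard hsub (Set.toFinite _)
      _ ≤ (Set.univ : Set (Fin k)).ncard := Set.ncard_image_le
      _ = k := by simp [Set.ncard_univ]
  push Not at hclique
  by_cases hhub : ∃ i, some (i, none) ∈ A
  · obtain ⟨i, hmem⟩ := hhub
    refine ⟨_, hmem, le_trans (Set.ncard_le_ncard (t := {none}) ?_) (by simpa using hk)⟩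
    rintro (_ | ⟨i', _ | ⟨j', a'⟩⟩) ⟨hA', hadj⟩
    · rfl
    · exact hadj.elim
    · exact absurd hA' (hclique _ _ _)
  push Not at hhub
  obtain ⟨v, hv⟩ := hA
  refine ⟨v, hv, le_trans (Set.ncard_le_ncard (t := ∅) ?_) (by simp)⟩
  rcases v with _ | ⟨i, _ | ⟨j, a⟩⟩
  · rintro (_ | ⟨i', _ | ⟨j', a'⟩⟩) ⟨hA', hadj⟩
    · exact hadj.elim
    · exact absurd hA' (hhub _)
    · exact absurd hA' (hclique _ _ _)
  · exact absurd hv (hhub _)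
  · exact absurd hv (hclique _ _ _)

theorem not_abColorable_cliqueTree {I J K : Type*} [Fintype I] [Fintype J] [Fintype K] {k l : ℕ}
    (hI : l < Fintype.card I) (hJ : l < Fintype.card J) (hK : k ≤ Fintype.card K) :
    ¬ ABColorable (cliqueTree I J K) k l := by
  rintro ⟨f, hf, hf'⟩
  obtain ⟨i, c, hc⟩ := exists_inl_of_neighbors hf' hI none (fun i => some (i, none))
    (fun i i' h => by simpa using h) (fun _ => trivial)
  have hclique : ∀ j, ∃ a d, f (some (i, some (j, a))) = Sum.inr d := fun j => by
    obtain ⟨o, d, hd⟩ := exists_inr_of_clique hf (ι := Option K)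
      (by rw [Fintype.card_option]; omega) (fun o => some (i, o.map (j, ·))) (by
        rintro (_ | a) (_ | a') hne
        · exact absurd rfl hne
        · exact rfl
        · exact rfl
        · exact ⟨rfl, rfl, fun h => hne (congrArg some h)⟩)
    rcases o with _ | a
    · exact absurd (hc.symm.trans hd) Sum.inl_ne_inr
    · exact ⟨a, d, hd⟩
  choose a d hd using hclique
  obtain ⟨j, c', hc'⟩ := exists_inl_of_neighbors hf' hJ (some (i, none))
    (fun j => some (i, some (j, a j))) (fun j j' h => by simp at h; exact h.1) (fun _ => rfl)
  exact absurd (hc'.symm.trans (hd j)) Sum.inl_ne_inr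

theorem stmt_3 (k l : ℕ) (hk : 1 ≤ k) (hl : 1 ≤ l) :
    ∃ G : SimpleGraph (Fin (k * l ^ 2 + (2 * k + 1) * l + k + 2)),
      KDegenerate G k ∧ ¬ ABColorable G k l := by
  have hcard : Fintype.card (CliqueTreeVertex (Fin (l + 1)) (Fin (l + 1)) (Fin k)) =
      k * l ^ 2 + (2 * k + 1) * l + k + 2 := by
    simp only [Fintype.card_option, Fintype.card_prod, Fintype.card_fin]
    ring
  let e := SimpleGraph.Iso.comap (Fintype.equivFinOfCardEq hcard).symm
    (cliqueTree (Fin (l + 1)) (Fin (l + 1)) (Fin k))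
  exact ⟨_, (cliqueTree_kDegenerate _ _ hk).of_iso e,
    fun h => not_abColorable_cliqueTree (by simp) (by simp) (by simp) (h.of_iso e.symm)⟩
end

section
/- Let G be a finite simple cactus graph of girth at least 4; that is, G contains no cycle of length 3, and every edge of G lies on at most one cycle (any two cycles of G that share an edge have the same edge set). Then G is (2,1)-colorable. -/
namespace SimpleGraph

variable {V : Type*} {G H : SimpleGraph V}

/-- Every edge lies on at most one cycle: two cycles sharing an edge have the same edges. -/
def IsCactus (G : SimpleGraph V) : Prop :=
  ∀ (u v : V) (c₁ : G.Walk u u) (c₂ : G.Walk v v), c₁.IsCycle → c₂.IsCycle →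
    (∃ e, e ∈ c₁.edges ∧ e ∈ c₂.edges) → {e | e ∈ c₁.edges} = {e | e ∈ c₂.edges}

theorem IsCactus.anti (hG : G.IsCactus) (hle : H ≤ G) : H.IsCactus := by
  intro u v c₁ c₂ h₁ h₂ he
  simpa using hG u v (c₁.mapLe hle) (c₂.mapLe hle) (h₁.mapLe hle) (h₂.mapLe hle) (by simpa using he)

theorem IsCactus.not_reachable_deleteEdges_of_base (hG : G.IsCactus) {x y : V} {c : G.Walk x x}
    (hc : c.IsCycle) (hy : y ∈ c.support) (hxy : x ≠ y) :
    ¬ (G.deleteEdges {e | e ∈ c.edges}).Reachable x y := by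
  classical
  cases c with
  | nil => simp at hc
  | @cons _ b _ h t =>
    intro hr
    have hyt : y ∈ t.support := by
      simpa [hxy.symm] using hy
    have hsplit : t.edges = (t.takeUntil y hyt).edges ++ (t.dropUntil y hyt).edges := by
      rw [← Walk.edges_append, Walk.take_spec]
    have hnd := hc.edges_nodup
    rw [Walk.edges_cons, hsplit] at hnd
    obtain ⟨hb, hnd⟩ := List.nodup_cons.mp hnd
    have hdisj := List.disjoint_of_nodup_append hnd
    rw [List.mem_append, not_or] at hb
    set K := G.deleteEdges {e | e ∈ (t.dropUntil y hyt).edges} with hK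
    have hxb : K.Adj x b := by
      simp [hK, deleteEdges_adj, h, hb.2]
    have hreach : (K.deleteEdges {s(x, b)}).Reachable x b := by
      rw [hK, deleteEdges_deleteEdges]
      refine (hr.mono (deleteEdges_anti ?_)).trans (Reachable.symm ?_)
      · intro e he
        simp only [Set.mem_union, Set.mem_ofPred_eq, Set.mem_singleton_iff] at he
        simp only [Set.mem_ofPred_eq, Walk.edges_cons, List.mem_cons, hsplit, List.mem_append]
        tauto
      · refine ⟨(t.takeUntil y hyt).toDeleteEdges _ ?_⟩
        intro e he
        simp only [Set.mem_union, Set.mem_ofPred_eq, Set.mem_singleton_iff, not_or]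
        exact ⟨fun h' => hdisj he h', fun h' => hb.1 (h' ▸ he)⟩
    obtain ⟨u, p, hp, he⟩ := adj_and_reachable_delete_edges_iff_exists_cycle.mp ⟨hxb, hreach⟩
    have hle : K ≤ G := deleteEdges_le _
    have heq := hG u x (p.mapLe hle) (Walk.cons h t) (hp.mapLe hle) hc
      ⟨s(x, b), by simpa using he, by simp⟩
    obtain ⟨e, he', -⟩ := (Walk.mem_support_iff_exists_mem_edges_of_not_nil
      (Walk.not_nil_of_ne hxy.symm)).mp (t.dropUntil y hyt).start_mem_support
    have hep : e ∈ p.edges := by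
      have : e ∈ {e | e ∈ (Walk.cons h t).edges} := by simp [hsplit, he']
      rw [← heq] at this
      simpa using this
    have := p.edges_subset_edgeSet hep
    simp [hK, edgeSet_deleteEdges, he'] at this

/-- The vertices of a cycle of a cactus lie in distinct components once its edges are deleted. -/
theorem IsCactus.not_reachable_deleteEdges (hG : G.IsCactus) {r x y : V} {c : G.Walk r r}
    (hc : c.IsCycle) (hx : x ∈ c.support) (hy : y ∈ c.support) (hxy : x ≠ y) :
    ¬ (G.deleteEdges {e | e ∈ c.edges}).Reachable x y := by
  classical
  have h := hG.not_reachable_deleteEdges_of_base (hc.rotate hx)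
    ((c.mem_support_rotate_iff x hx).mpr hy) hxy
  simpa only [(c.rotate_edges x hx).mem_iff] using h

/-- `G` has a 2-independent set that contains `A`, avoids the closed neighborhoods of the elements
of `B`, and meets every cycle. -/
def HasCycleTransversal (G : SimpleGraph V) (A B : Set V) : Prop :=
  ∃ S : Set V, A ⊆ S ∧ (∀ b ∈ B, b ∉ S ∧ ∀ z, G.Adj b z → z ∉ S) ∧ TwoIndepOn G S ∧
    ∀ (v : V) (c : G.Walk v v), c.IsCycle → ∃ x ∈ S, x ∈ c.support

/-- `A` and `B` are disjoint and the elements of their union lie in distinct components. -/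
def IsRootPair (G : SimpleGraph V) (A B : Set V) : Prop :=
  Disjoint A B ∧ (A ∪ B).Pairwise fun u v => ¬ G.Reachable u v

/-- Pieces of `G` hanging off the vertices of `W` are glued along `W`. -/
theorem hasCycleTransversal_of_glue {A B W Y : Set V} {r : V} (hle : H ≤ G)
    (hAB : G.IsRootPair A B) (hr : r ∈ A ∪ B) (hrW : r ∈ W) (hYW : Y ⊆ W) (hY : Y.Subsingleton)
    (hedge : ∀ u v, G.Adj u v → H.Adj u v ∨ (u ∈ W ∧ v ∈ W))
    (hW : W.Pairwise fun u v => ¬ H.Reachable u v)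
    (hWr : ∀ w ∈ W, G.Reachable w r)
    (hrA : r ∈ A → r ∈ Y) (hrB : r ∈ B → r ∉ Y ∧ ∀ y ∈ Y, ¬ G.Adj r y)
    (hcyc : ∀ (v : V) (c : G.Walk v v), c.IsCycle →
      (∀ e ∈ c.edges, e ∈ H.edgeSet) ∨ ∃ y ∈ Y, y ∈ c.support)
    (ih : ∀ A' B' : Set V, H.IsRootPair A' B' → H.HasCycleTransversal A' B') :
    G.HasCycleTransversal A B := by
  obtain ⟨hdisj, hpw⟩ := hAB
  have huniq : ∀ w ∈ W, w ∈ A ∪ B → w = r := fun w hw hw' => by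
    by_contra hne
    exact hpw hw' hr hne (hWr w hw)
  have hroot : H.IsRootPair (A ∪ Y) (B ∪ (W \ Y)) := by
    refine ⟨?_, ?_⟩
    · rw [Set.disjoint_left] at hdisj ⊢
      rintro a (ha | ha) (hb | hb)
      · exact hdisj ha hb
      · obtain rfl := huniq a hb.1 (Or.inl ha)
        exact hb.2 (hrA ha)
      · obtain rfl := huniq a (hYW ha) (Or.inr hb)
        exact (hrB hb).1 ha
      · exact hb.2 ha
    · have hmem : ∀ u ∈ (A ∪ Y) ∪ (B ∪ (W \ Y)), u ∈ A ∪ B ∨ u ∈ W := by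
        rintro u ((h | h) | (h | h))
        · exact Or.inl (Or.inl h)
        · exact Or.inr (hYW h)
        · exact Or.inl (Or.inr h)
        · exact Or.inr h.1
      have hmix : ∀ u v, u ∈ A ∪ B → v ∈ W → u ≠ v → ¬ H.Reachable u v := by
        intro u v hu hv huv huv'
        have : u = r := by
          by_contra hne
          exact hpw hu hr hne ((huv'.mono hle).trans (hWr v hv))
        exact hW (this ▸ hrW) hv huv huv'
      intro u hu v hv huv huv'
      rcases hmem u hu with hu | hu <;> rcases hmem v hv with hv | hv
      · exact hpw hu hv huv (huv'.mono hle)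
      · exact hmix u v hu hv huv huv'
      · exact hmix v u hv hu huv.symm huv'.symm
      · exact hW hu hv huv huv'
  obtain ⟨S, hAS, hBS, hS, hSc⟩ := ih _ _ hroot
  have hWS : ∀ w ∈ W, w ∈ S → w ∈ Y := fun w hw hwS => by
    by_contra hwY
    exact (hBS w (Or.inr ⟨hw, hwY⟩)).1 hwS
  have hmid : ∀ u w v, u ∈ S → v ∈ S → u ∈ W → w ∈ W → G.Adj u w → ¬ H.Adj w v := by
    intro u w v hu hv huW hwW huw hwv
    have hwY : w ∉ Y := fun hwY => huw.ne (hY (hWS u huW hu) hwY)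
    exact (hBS w (Or.inr ⟨hwW, hwY⟩)).2 v hwv hv
  refine ⟨S, fun a ha => hAS (Or.inl ha), ?_, ?_, ?_⟩
  · intro b hb
    refine ⟨(hBS b (Or.inl hb)).1, fun z hbz hz => ?_⟩
    rcases hedge b z hbz with h | ⟨hbW, hzW⟩
    · exact (hBS b (Or.inl hb)).2 z h hz
    · obtain rfl := huniq b hbW (Or.inr hb)
      exact (hrB hb).2 z (hWS z hzW hz) hbz
  · intro u hu v hv huv
    have hnW : u ∈ W → v ∉ W := fun huW hvW => huv (hY (hWS u huW hu) (hWS v hvW hv))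
    refine ⟨fun h => ?_, fun w ⟨huw, hwv⟩ => ?_⟩
    · rcases hedge u v h with h | h
      · exact (hS hu hv huv).1 h
      · exact hnW h.1 h.2
    · rcases hedge u w huw with h₁ | h₁ <;> rcases hedge w v hwv with h₂ | h₂
      · exact (hS hu hv huv).2 w ⟨h₁, h₂⟩
      · exact hmid v w u hv hu h₂.2 h₂.1 hwv.symm h₁.symm
      · exact hmid u w v hu hv h₁.1 h₁.2 huw h₂
      · exact hnW h₁.1 h₂.2
  · intro v c hc
    rcases hcyc v c hc with h | ⟨y, hy, hyc⟩
    · simpa using hSc v (c.transfer H h) (hc.transfer h)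
    · exact ⟨y, hAS (Or.inr hy), hyc⟩

theorem hasCycleTransversal_of_adj (hG : G.IsCactus)
    (htri : ∀ a b c, G.Adj a b → G.Adj b c → ¬ G.Adj a c) {A B : Set V} (hAB : G.IsRootPair A B)
    {r x : V} (hr : r ∈ A ∪ B) (hrx : G.Adj r x)
    (ih : ∀ H < G, ∀ A' B' : Set V, H.IsRootPair A' B' → H.HasCycleTransversal A' B') :
    G.HasCycleTransversal A B := by
  classical
  have hlt : ∀ s : Set (Sym2 V), s(r, x) ∈ s → G.deleteEdges s < G := fun s hs =>
    lt_of_le_of_ne (deleteEdges_le s) fun h => by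
      have : (G.deleteEdges s).Adj r x := by rwa [h]
      exact (deleteEdges_adj.mp this).2 hs
  have hdisj := Set.disjoint_left.mp hAB.1
  by_cases hbr : (G.deleteEdges {s(r, x)}).Reachable r x
  · obtain ⟨u, c', hc', he'⟩ := adj_and_reachable_delete_edges_iff_exists_cycle.mp ⟨hrx, hbr⟩
    obtain ⟨c, hc, he⟩ : ∃ c : G.Walk r r, c.IsCycle ∧ s(r, x) ∈ c.edges :=
      have hrc := c'.fst_mem_support_of_mem_edges he'
      ⟨c'.rotate r hrc, hc'.rotate hrc, (c'.rotate_edges r hrc).mem_iff.mpr he'⟩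
    obtain ⟨y, hyc, hyr, hry⟩ : ∃ y ∈ c.support, y ≠ r ∧ ¬ G.Adj r y := by
      cases c with
      | nil => simp at hc
      | @cons _ a _ h p =>
        cases p with
        | nil => exact absurd rfl h.ne
        | @cons _ b _ h' q =>
          refine ⟨b, by simp, ?_, htri r a b h h'⟩
          rintro rfl
          have := hc.edges_nodup
          simp [Sym2.eq_swap] at this
    obtain ⟨y, hyc, hyA, hyB⟩ : ∃ y ∈ c.support,
        (r ∈ A → r = y) ∧ (r ∈ B → r ≠ y ∧ ¬ G.Adj r y) := by
      by_cases hrA : r ∈ A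
      · exact ⟨r, c.start_mem_support, fun _ => rfl, fun h => absurd h (hdisj hrA)⟩
      · exact ⟨y, hyc, fun h => absurd h hrA, fun _ => ⟨hyr.symm, hry⟩⟩
    refine hasCycleTransversal_of_glue (W := {v | v ∈ c.support}) (Y := {y}) (deleteEdges_le _) hAB hr
      c.start_mem_support (by simpa using hyc) Set.subsingleton_singleton ?_
      (fun u hu v hv => hG.not_reachable_deleteEdges hc hu hv)
      (fun w hw => ⟨(c.takeUntil w hw).reverse⟩) (by simpa using hyA) (by simpa using hyB) ?_
      (ih _ (hlt _ he))
    · intro u v huv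
      by_cases h : s(u, v) ∈ c.edges
      · exact Or.inr ⟨c.fst_mem_support_of_mem_edges h, c.snd_mem_support_of_mem_edges h⟩
      · exact Or.inl (deleteEdges_adj.mpr ⟨huv, h⟩)
    · intro v d hd
      by_cases h : ∃ e, e ∈ d.edges ∧ e ∈ c.edges
      · right
        refine ⟨y, rfl, ?_⟩
        have heq := hG _ _ d c hd hc h
        rw [Walk.mem_support_iff_exists_mem_edges_of_not_nil hc.not_nil] at hyc
        obtain ⟨e, hec, hye⟩ := hyc
        have hed : e ∈ {e | e ∈ d.edges} := heq ▸ hec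
        exact (Walk.mem_support_iff_exists_mem_edges_of_not_nil hd.not_nil).mpr ⟨e, hed, hye⟩
      · left
        intro e hed
        rw [edgeSet_deleteEdges]
        exact ⟨d.edges_subset_edgeSet hed, fun hec => h ⟨e, hed, hec⟩⟩
  · refine hasCycleTransversal_of_glue (W := {r, x}) (Y := {y | y = r ∧ r ∈ A}) (deleteEdges_le _)
      hAB hr (by simp) (fun y hy => Or.inl hy.1) (fun u hu v hv => hu.1.trans hv.1.symm) ?_ ?_ ?_
      (fun h => ⟨rfl, h⟩) (fun h => ⟨fun h' => hdisj h'.2 h, fun y hy => absurd h (hdisj hy.2)⟩) ?_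
      (ih _ (hlt {s(r, x)} rfl))
    · intro u v huv
      by_cases h : s(u, v) = s(r, x)
      · right
        rcases Sym2.eq_iff.mp h with ⟨rfl, rfl⟩ | ⟨rfl, rfl⟩ <;> simp
      · exact Or.inl (deleteEdges_adj.mpr ⟨huv, h⟩)
    · rintro u (rfl | rfl) v (rfl | rfl) huv
      · exact absurd rfl huv
      · exact hbr
      · exact fun h => hbr h.symm
      · exact absurd rfl huv
    · rintro w (rfl | rfl)
      · rfl
      · exact hrx.symm.reachable
    · intro v c hc
      left
      intro e hec
      rw [edgeSet_deleteEdges]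
      refine ⟨c.edges_subset_edgeSet hec, ?_⟩
      rintro rfl
      exact hbr (adj_and_reachable_delete_edges_iff_exists_cycle.mpr ⟨v, c, hc, hec⟩).2

theorem IsCactus.hasCycleTransversal [Finite V] (hG : G.IsCactus)
    (htri : ∀ a b c, G.Adj a b → G.Adj b c → ¬ G.Adj a c) {A B : Set V}
    (hAB : G.IsRootPair A B) : G.HasCycleTransversal A B := by
  induction G using WellFoundedLT.induction generalizing A B with
  | ind G ih =>
    have ih' : ∀ H < G, ∀ A' B' : Set V, H.IsRootPair A' B' → H.HasCycleTransversal A' B' :=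
      fun H hH A' B' h => ih H hH (hG.anti hH.le)
        (fun a b c hab hbc hac => htri a b c (hH.le hab) (hH.le hbc) (hH.le hac)) h
    by_cases hR : ∃ r ∈ A ∪ B, ∃ x, G.Adj r x
    · obtain ⟨r, hr, x, hrx⟩ := hR
      exact hasCycleTransversal_of_adj hG htri hAB hr hrx ih'
    push Not at hR
    have hisol : ∀ r ∈ A ∪ B, ∀ v, r ≠ v → ¬ G.Reachable r v := by
      rintro r hr v hrv ⟨p⟩
      cases p with
      | nil => exact hrv rfl
      | cons h _ => exact hR r hr _ h
    by_cases hE : ∃ v x, G.Adj v x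
    · obtain ⟨v, x, hvx⟩ := hE
      have hv : v ∉ A ∪ B := fun h => hR v h x hvx
      have hAB' : G.IsRootPair A (insert v B) := by
        refine ⟨Set.disjoint_insert_right.mpr ⟨fun h => hv (Or.inl h), hAB.1⟩, ?_⟩
        rw [Set.union_insert]
        intro a ha b hb hab hreach
        rcases ha with rfl | ha
        · rcases hb with rfl | hb
          · exact hab rfl
          · exact hisol b hb a hab.symm hreach.symm
        · exact hisol a ha b hab hreach
      obtain ⟨S, hAS, hBS, hS⟩ :=
        hasCycleTransversal_of_adj hG htri hAB' (Or.inr (Set.mem_insert v B)) hvx ih'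
      exact ⟨S, hAS, fun b hb => hBS b (Or.inr hb), hS⟩
    · push Not at hE
      refine ⟨A, subset_rfl, fun b hb => ⟨fun h => Set.disjoint_left.mp hAB.1 h hb, ?_⟩, ?_, ?_⟩
      · exact fun z h => absurd h (hE b z)
      · exact fun u _ v _ _ => ⟨hE u v, fun w h => hE u w h.1⟩
      · intro v c hc
        cases c with
        | nil => simp at hc
        | cons h _ => exact absurd h (hE _ _)

theorem isAcyclic_induce_compl_of_forall_isCycle {S : Set V}
    (hS : ∀ (v : V) (c : G.Walk v v), c.IsCycle → ∃ x ∈ S, x ∈ c.support) :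
    (G.induce Sᶜ).IsAcyclic := by
  intro v c hc
  obtain ⟨x, hxS, hx⟩ := hS _ (c.map (Embedding.induce Sᶜ).toHom)
    (hc.map (Embedding.induce (G := G) Sᶜ).injective)
  rw [Walk.support_map, List.mem_map] at hx
  obtain ⟨z, -, rfl⟩ := hx
  exact z.2 hxS

end SimpleGraph

theorem stmt_5 {V : Type*} [Fintype V] (G : SimpleGraph V)
    (htrianglefree : ∀ (v : V) (c : G.Walk v v), c.IsCycle → c.length ≠ 3)
    (hcactus : ∀ (u v : V) (c₁ : G.Walk u u) (c₂ : G.Walk v v),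
      c₁.IsCycle → c₂.IsCycle → (∃ e, e ∈ c₁.edges ∧ e ∈ c₂.edges) →
      {e | e ∈ c₁.edges} = {e | e ∈ c₂.edges}) :
    ABColorable G 2 1 := by
  classical
  have htri : ∀ a b c, G.Adj a b → G.Adj b c → ¬ G.Adj a c := by
    intro a b c hab hbc hac
    refine htrianglefree a (.cons hab (.cons hbc (.cons hac.symm .nil))) ?_ rfl
    simp [SimpleGraph.Walk.cons_isCycle_iff, hab.ne, hab.ne', hbc.ne, hac.ne, hac.ne']
  have hG : G.IsCactus := hcactus
  obtain ⟨S, -, -, hS, hSc⟩ := hG.hasCycleTransversal htri (A := ∅) (B := ∅) (by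
    simp [SimpleGraph.IsRootPair])
  obtain ⟨C⟩ := (SimpleGraph.isAcyclic_induce_compl_of_forall_isCycle hSc).colorable_two
  refine ⟨fun v => if h : v ∈ S then Sum.inr 0 else Sum.inl (C ⟨v, h⟩), ?_, ?_⟩
  · intro i u hu v hv huv
    by_cases huS : u ∈ S
    · simp [huS] at hu
    by_cases hvS : v ∈ S
    · simp [hvS] at hv
    simp only [Set.mem_ofPred_eq, huS, hvS, dite_false, Sum.inl.injEq] at hu hv
    exact C.valid (v := ⟨u, huS⟩) (w := ⟨v, hvS⟩) huv (hu.trans hv.symm)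
  · intro j u hu v hv
    have hmem : ∀ w, w ∈ {v | (if h : v ∈ S then Sum.inr 0 else Sum.inl (C ⟨v, h⟩) :
        Fin 2 ⊕ Fin 1) = Sum.inr j} → w ∈ S := fun w hw => by
      by_contra h
      simp [h] at hw
    exact hS (hmem u hu) (hmem v hv)
end

section
/- Let G be a finite acyclic simple graph (a forest) on n vertices. Then for every natural number b with b ≥ 4·√(2·n) (as real numbers), G is (1,b)-colorable. -/
open Finset in
/-- Greedy coloring along a ranking of the vertices. -/
theorem SimpleGraph.colorable_of_card_lower_neighbors_lt {V : Type*} [Fintype V]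
    (K : SimpleGraph V) [DecidableRel K.Adj] (f : V → ℕ) (D : ℕ)
    (h : ∀ v, #{u | K.Adj v u ∧ f u ≤ f v} < D) : K.Colorable D := by
  classical
  have key : ∀ s : Finset V, ∃ c : V → Fin D,
      ∀ u ∈ s, ∀ v ∈ s, K.Adj u v → c u ≠ c v := by
    intro s
    induction s using Finset.induction_on_max_value f with
    | empty => exact ⟨fun v => ⟨0, (Nat.zero_le _).trans_lt (h v)⟩, by simp⟩
    | insert a s ha hmax ih =>
      obtain ⟨c, hc⟩ := ih
      obtain ⟨k, hk⟩ : ∃ k, k ∉ image c {u | K.Adj a u ∧ f u ≤ f a} := by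
        by_contra! hall
        have hle : D ≤ #(image c {u | K.Adj a u ∧ f u ≤ f a}) := by
          rw [eq_univ_of_forall hall, card_univ, Fintype.card_fin]
        exact absurd (hle.trans card_image_le) (h a).not_ge
      have hk' : ∀ u ∈ s, K.Adj a u → c u ≠ k := fun u hu hau hcu =>
        hk (mem_image.2 ⟨u, by simpa using ⟨hau, hmax u hu⟩, hcu⟩)
      refine ⟨Function.update c a k, fun u hu v hv huv => ?_⟩
      rcases mem_insert.1 hu with rfl | hus <;> rcases mem_insert.1 hv with rfl | hvs
      · exact absurd huv (K.irrefl)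
      · rw [Function.update_self, Function.update_of_ne huv.ne']
        exact (hk' v hvs huv).symm
      · rw [Function.update_self, Function.update_of_ne huv.ne]
        exact hk' u hus huv.symm
      · rw [Function.update_of_ne (by rintro rfl; exact ha hus),
          Function.update_of_ne (by rintro rfl; exact ha hvs)]
        exact hc u hus v hvs huv
  obtain ⟨c, hc⟩ := key univ
  exact ⟨SimpleGraph.Coloring.mk c fun {u v} huv => hc u (mem_univ _) v (mem_univ _) huv⟩

/-- Ranking the vertices of a forest by the distance to the root of their component. -/
theorem SimpleGraph.IsAcyclic.exists_rank {V : Type*} {G : SimpleGraph V} (hG : G.IsAcyclic) :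
    ∃ f : V → ℕ, (∀ u v, G.Adj u v → f u ≠ f v) ∧
      ∀ u v w, G.Adj u v → G.Adj w v → f u < f v → f w < f v → u = w := by
  let r : V → V := fun v => (G.connectedComponentMk v).out
  have hr : ∀ v, G.Reachable (r v) v := fun v =>
    SimpleGraph.ConnectedComponent.exact (G.connectedComponentMk v).out_eq
  have hrr : ∀ u v, G.Adj u v → r u = r v := fun u v huv => by
    simp only [r, SimpleGraph.ConnectedComponent.sound huv.reachable]
  refine ⟨fun v => G.dist (r v) v, fun u v huv => ?_, fun u v w huv hwv hu hw => ?_⟩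
  · simp only [hrr u v huv]
    exact hG.dist_ne_of_adj huv (hrr u v huv ▸ hr u)
  · obtain ⟨p, hp, hpl⟩ := (hr v).exists_path_of_dist
    have key : ∀ x, G.Adj x v → G.dist (r x) x < G.dist (r v) v → x = p.penultimate := by
      intro x hxv hx
      refine hG.eq_penultimate_of_adj_end hp hxv.symm ?_
      rw [hrr x v hxv] at hx
      obtain ⟨q, hq, hql⟩ := ((hr v).trans hxv.symm.reachable).exists_path_of_dist
      by_contra hxp
      have hvq := hG.mem_support_of_ne_mem_support_of_adj_of_isPath hq hp hxv hxp
      have := congrArg SimpleGraph.Walk.length (hG.path_concat hp hq hxv.symm hvq)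
      rw [SimpleGraph.Walk.length_concat] at this
      omega
    rw [key u huv hu, key w hwv hw]

open Finset in
theorem SimpleGraph.sum_degree_le_of_rank {V : Type*} [Fintype V] (G : SimpleGraph V)
    [DecidableRel G.Adj] (f : V → ℕ) (hne : ∀ u v, G.Adj u v → f u ≠ f v)
    (huniq : ∀ u v w, G.Adj u v → G.Adj w v → f u < f v → f w < f v → u = w) :
    ∑ v, G.degree v ≤ 2 * Fintype.card V := by
  classical
  have hsplit : ∀ v, G.degree v =
      #{u | G.Adj u v ∧ f u < f v} + #{u | G.Adj v u ∧ f v < f u} := by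
    intro v
    rw [← card_union_of_disjoint (by
      rw [disjoint_filter]; intro u _ h1 h2; omega), ← G.card_neighborFinset_eq_degree]
    congr 1
    ext u
    simp only [mem_neighborFinset, mem_union, mem_filter, mem_univ, true_and]
    constructor
    · intro h
      rcases (hne v u h).lt_or_gt with h' | h'
      · exact .inr ⟨h, h'⟩
      · exact .inl ⟨h.symm, h'⟩
    · rintro (h | h)
      · exact h.1.symm
      · exact h.1
  have hle : ∑ v, #{u | G.Adj u v ∧ f u < f v} ≤ Fintype.card V := by
    refine (sum_le_card_nsmul univ _ 1 fun v _ => ?_).trans (by simp)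
    rw [card_le_one]
    intro u hu w hw
    simp only [mem_filter, mem_univ, true_and] at hu hw
    exact huniq u v w hu.1 hw.1 hu.2 hw.2
  have hdc : ∑ v, #{u | G.Adj v u ∧ f v < f u} = ∑ v, #{u | G.Adj u v ∧ f u < f v} :=
    sum_card_bipartiteAbove_eq_sum_card_bipartiteBelow (s := univ) (t := univ)
      (fun u v => G.Adj u v ∧ f u < f v)
  rw [sum_congr rfl fun v _ => hsplit v, sum_add_distrib, hdc]
  omega

open Finset in
/-- A forest is `(1, h + D)`-colorable when it has at most `h` vertices of degree at least `D`. -/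
theorem SimpleGraph.IsAcyclic.abColorable_one {V : Type*} [Fintype V] {G : SimpleGraph V}
    [DecidableRel G.Adj] (hG : G.IsAcyclic) {h D b : ℕ} (hD : 0 < D)
    (hcard : #{v | D ≤ G.degree v} ≤ h) (hb : h + D ≤ b) : ABColorable G 1 b := by
  classical
  obtain ⟨f, hne, huniq⟩ := hG.exists_rank
  let H : Finset V := {v | D ≤ G.degree v}
  let R : V → Prop := fun v => v ∉ H ∧ ∀ p, G.Adj p v → f p < f v → p ∉ H
  let K : SimpleGraph V := SimpleGraph.fromRel fun u v =>
    R u ∧ R v ∧ (G.Adj u v ∨ ∃ w, G.Adj u w ∧ G.Adj w v)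
  have hKadj : ∀ u v, K.Adj u v →
      u ≠ v ∧ R u ∧ R v ∧ (G.Adj u v ∨ ∃ w, G.Adj u w ∧ G.Adj w v) := by
    rintro u v ⟨hn, hr | ⟨h1, h2, h3 | ⟨w, h3, h4⟩⟩⟩
    · exact ⟨hn, hr⟩
    · exact ⟨hn, h2, h1, .inl h3.symm⟩
    · exact ⟨hn, h2, h1, .inr ⟨w, h4.symm, h3.symm⟩⟩
  have hK : K.Colorable D := by
    refine K.colorable_of_card_lower_neighbors_lt f D fun v => ?_
    by_cases hp : R v ∧ ∃ p, G.Adj p v ∧ f p < f v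
    · obtain ⟨hR, p, hpv, hfp⟩ := hp
      have hpH : ¬ D ≤ G.degree p := by simpa [H] using hR.2 p hpv hfp
      refine lt_of_le_of_lt ?_ (not_le.1 hpH)
      have hmem : v ∈ G.neighborFinset p := by simpa using hpv
      have hsub : ({u | K.Adj v u ∧ f u ≤ f v} : Finset V) ⊆
          insert p ((G.neighborFinset p).erase v) := by
        intro u hu
        simp only [mem_filter, mem_univ, true_and] at hu
        obtain ⟨hvu, hfu⟩ := hu
        obtain ⟨hn, -, -, hadj | ⟨w, hvw, hwu⟩⟩ := hKadj v u hvu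
        · exact mem_insert.2 <| .inl <|
            huniq u v p hadj.symm hpv (hfu.lt_of_ne (hne v u hadj).symm) hfp
        · rcases (hne v w hvw).lt_or_gt with hlt | hlt
          · exact absurd (huniq v w u hvw hwu.symm hlt (hfu.trans_lt hlt)) hn
          · obtain rfl := huniq w v p hvw.symm hpv hlt hfp
            simp [hn.symm, hwu]
      refine (card_le_card hsub).trans ((card_insert_le _ _).trans ?_)
      rw [card_erase_add_one hmem, G.card_neighborFinset_eq_degree]
    · rw [filter_eq_empty_iff.2, card_empty]
      · exact hD
      rintro u - ⟨hvu, hfu⟩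
      obtain ⟨hn, hR, -, hadj | ⟨w, hvw, hwu⟩⟩ := hKadj v u hvu
      · exact hp ⟨hR, u, hadj.symm, hfu.lt_of_ne (hne v u hadj).symm⟩
      · rcases (hne v w hvw).lt_or_gt with hlt | hlt
        · exact hn (huniq v w u hvw hwu.symm hlt (hfu.trans_lt hlt))
        · exact hp ⟨hR, w, hvw.symm, hlt⟩
  obtain ⟨c⟩ := hK
  have hidx : ∀ x : H, (H.equivFin x : ℕ) < h := fun x => (H.equivFin x).2.trans_le hcard
  let g : V → Fin 1 ⊕ Fin b := fun v =>
    if hv : v ∈ H then .inr ⟨H.equivFin ⟨v, hv⟩, by have := hidx ⟨v, hv⟩; omega⟩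
    else if R v then .inr ⟨h + c v, by have := (c v).2; omega⟩
    else .inl 0
  have hgH : ∀ v (hv : v ∈ H), g v = .inr ⟨H.equivFin ⟨v, hv⟩, by
      have := hidx ⟨v, hv⟩; omega⟩ := fun v hv => by simp only [g, dif_pos hv]
  have hgR : ∀ v, R v → g v = .inr ⟨h + c v, by have := (c v).2; omega⟩ := fun v hv => by
    simp only [g, dif_neg hv.1, if_pos hv]
  have hgI : ∀ v, v ∉ H → ¬ R v → g v = .inl 0 := fun v hv hR => by
    simp only [g, dif_neg hv, if_neg hR]
  refine ⟨g, fun i u hu v hv huv => ?_, fun j u hu v hv hn => ?_⟩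
  · have hI : ∀ x, g x = .inl i → x ∉ H ∧ ∃ p, G.Adj p x ∧ f p < f x ∧ p ∈ H := by
      intro x hx
      have hxH : x ∉ H := fun hxH => by simp [hgH x hxH] at hx
      refine ⟨hxH, ?_⟩
      by_contra! hno
      simp [hgR x ⟨hxH, hno⟩] at hx
    obtain ⟨huH, p, hpu, hfp, hpH⟩ := hI u hu
    obtain ⟨hvH, q, hqv, hfq, hqH⟩ := hI v hv
    rcases (hne u v huv).lt_or_gt with hlt | hlt
    · exact huH (huniq u v q huv hqv hlt hfq ▸ hqH)
    · exact hvH (huniq v u p huv.symm hpu hlt hfp ▸ hpH)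
  · replace hu : g u = .inr j := hu
    replace hv : g v = .inr j := hv
    have hR : ∀ x, g x = .inr j → x ∉ H → R x := fun x hx hxH => by
      by_contra hRx
      simp [hgI x hxH hRx] at hx
    by_cases huH : u ∈ H <;> by_cases hvH : v ∈ H
    · have heq := hu.trans hv.symm
      rw [hgH u huH, hgH v hvH, Sum.inr.injEq, Fin.mk.injEq] at heq
      exact absurd (congrArg Subtype.val (H.equivFin.injective (Fin.ext heq))) hn
    · have heq := hu.trans hv.symm
      rw [hgH u huH, hgR v (hR v hv hvH), Sum.inr.injEq, Fin.mk.injEq] at heq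
      have := hidx ⟨u, huH⟩
      omega
    · have heq := hu.trans hv.symm
      rw [hgR u (hR u hu huH), hgH v hvH, Sum.inr.injEq, Fin.mk.injEq] at heq
      have := hidx ⟨v, hvH⟩
      omega
    · have hRu := hR u hu huH
      have hRv := hR v hv hvH
      have heq := hu.trans hv.symm
      rw [hgR u hRu, hgR v hRv, Sum.inr.injEq, Fin.mk.injEq] at heq
      have hc : ¬ K.Adj u v := fun hadj => c.valid hadj (Fin.ext (by omega))
      have hno : ¬ (G.Adj u v ∨ ∃ w, G.Adj u w ∧ G.Adj w v) := fun hor =>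
        hc ⟨hn, .inl ⟨hRu, hRv, hor⟩⟩
      push Not at hno
      exact ⟨hno.1, fun w hw => hno.2 w hw.1 hw.2⟩

theorem stmt_6 {V : Type*} [Fintype V] (G : SimpleGraph V) (hG : G.IsAcyclic) (b : ℕ)
    (hb : 4 * Real.sqrt (2 * (Fintype.card V : ℝ)) ≤ (b : ℝ)) :
    ABColorable G 1 b := by
  classical
  rcases isEmpty_or_nonempty V with hV | hV
  · exact ⟨isEmptyElim, fun _ u => isEmptyElim u, fun _ u => isEmptyElim u⟩
  have hn : 0 < Fintype.card V := Fintype.card_pos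
  obtain ⟨f, hne, huniq⟩ := hG.exists_rank
  have hsum := G.sum_degree_le_of_rank f hne huniq
  let s := Nat.sqrt (2 * Fintype.card V)
  have hs : 2 * Fintype.card V < (s + 1) * (s + 1) := Nat.lt_succ_sqrt _
  have hs1 : 1 ≤ s := Nat.le_sqrt.2 (by omega)
  have hsb : 4 * s ≤ b := by
    have h1 : (s : ℝ) ≤ Real.sqrt (2 * (Fintype.card V : ℝ)) := by
      simpa using Real.nat_sqrt_le_real_sqrt (a := 2 * Fintype.card V)
    exact_mod_cast (mul_le_mul_of_nonneg_left h1 (by norm_num : (0 : ℝ) ≤ 4)).trans hb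
  refine hG.abColorable_one (h := s) (D := s + 1) s.succ_pos ?_ (by omega)
  have hle : (Finset.univ.filter fun v => s + 1 ≤ G.degree v).card * (s + 1) ≤
      ∑ v, G.degree v :=
    (Finset.card_nsmul_le_sum _ (fun v => G.degree v) (s + 1) fun v hv =>
      (Finset.mem_filter.1 hv).2).trans (Finset.sum_le_sum_of_subset (Finset.filter_subset _ _))
  exact Nat.le_of_lt_succ (lt_of_mul_lt_mul_right ((hle.trans hsum).trans_lt hs) (Nat.zero_le _))
end

section
/- Let G be a finite simple graph, let S be a set of vertices of G, and let a, b, c be natural numbers. Denote by N[S] the closed neighborhood of S (all vertices of S together with all vertices adjacent to a vertex of S) and by N(S)∖S the set of vertices outside S adjacent to some vertex of S. Suppose that (i) the subgraph of G induced on the complement of S can be partitioned into c sets each of which is 2-independent in that induced subgraph, and (ii) the subgraph of G induced on N[S] is (a,b)-colorable (as a graph in its own right) by a coloring in which every 2-independent color class contains at most one vertex of N(S)∖S. Then G is (a, b+c)-colorable. -/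
/-- The closed neighborhood `N[S]` of a set of vertices: all vertices of `S`
together with all vertices adjacent to a vertex of `S`. -/
def closedNbhd {V : Type*} (G : SimpleGraph V) (S : Set V) : Set V :=
  S ∪ {v | ∃ u ∈ S, G.Adj u v}

/-- The exterior neighborhood `N(S) ∖ S`: vertices outside `S` adjacent to some
vertex of `S`. -/
def extNbhd {V : Type*} (G : SimpleGraph V) (S : Set V) : Set V :=
  {v | v ∉ S ∧ ∃ u ∈ S, G.Adj u v}

theorem subset_closedNbhd {V : Type*} (G : SimpleGraph V) (S : Set V) :
    S ⊆ closedNbhd G S :=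
  Set.subset_union_left

theorem mem_closedNbhd_of_adj {V : Type*} {G : SimpleGraph V} {S : Set V} {u v : V}
    (hu : u ∈ S) (h : G.Adj u v) : v ∈ closedNbhd G S :=
  Or.inr ⟨u, hu, h⟩

theorem mem_extNbhd_of_mem_closedNbhd {V : Type*} {G : SimpleGraph V} {S : Set V} {v : V}
    (hv : v ∈ closedNbhd G S) (hS : v ∉ S) : v ∈ extNbhd G S :=
  ⟨hS, hv.resolve_left hS⟩

/-- A set that is 2-independent in `G[N[S]]` and meets `N(S) ∖ S` at most once is
2-independent in `G`. -/
theorem TwoIndepOn.image_of_closedNbhd {V : Type*} {G : SimpleGraph V} {S : Set V}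
    {t : Set (closedNbhd G S)} (ht : TwoIndepOn (G.induce (closedNbhd G S)) t)
    (hsub : {v : closedNbhd G S | v ∈ t ∧ (v : V) ∈ extNbhd G S}.Subsingleton) :
    TwoIndepOn G (Subtype.val '' t) := by
  rintro _ ⟨u, hu, rfl⟩ _ ⟨v, hv, rfl⟩ huv
  have huv' : u ≠ v := fun h => huv (congrArg _ h)
  obtain ⟨hadj, hcommon⟩ := ht hu hv huv'
  refine ⟨hadj, fun w ⟨huw, hwv⟩ => ?_⟩
  by_cases huS : (u : V) ∈ S
  · exact hcommon ⟨w, mem_closedNbhd_of_adj huS huw⟩ ⟨huw, hwv⟩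
  by_cases hvS : (v : V) ∈ S
  · exact hcommon ⟨w, mem_closedNbhd_of_adj hvS hwv.symm⟩ ⟨huw, hwv⟩
  exact huv' (hsub ⟨hu, mem_extNbhd_of_mem_closedNbhd u.2 huS⟩
    ⟨hv, mem_extNbhd_of_mem_closedNbhd v.2 hvS⟩)

/-- A set that is 2-independent in `G[V ∖ S]` and avoids `N[S]` is 2-independent in `G`. -/
theorem TwoIndepOn.image_of_compl {V : Type*} {G : SimpleGraph V} {S : Set V}
    {t : Set (Sᶜ : Set V)} (ht : TwoIndepOn (G.induce (Sᶜ : Set V)) t)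
    (hdisj : ∀ v ∈ t, (v : V) ∉ closedNbhd G S) :
    TwoIndepOn G (Subtype.val '' t) := by
  rintro _ ⟨u, hu, rfl⟩ _ ⟨v, hv, rfl⟩ huv
  obtain ⟨hadj, hcommon⟩ := ht hu hv fun h => huv (congrArg _ h)
  refine ⟨hadj, fun w ⟨huw, hwv⟩ => ?_⟩
  exact hcommon ⟨w, fun hw => hdisj u hu (mem_closedNbhd_of_adj hw huw.symm)⟩ ⟨huw, hwv⟩

theorem TwoIndepOn.mono {V : Type*} {G : SimpleGraph V} {s t : Set V}
    (ht : TwoIndepOn G t) (h : s ⊆ t) : TwoIndepOn G s :=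
  fun _ hu _ hv huv => ht (h hu) (h hv) huv

theorem stmt_7 {V : Type*} [Fintype V] (G : SimpleGraph V) (S : Set V) (a b c : ℕ)
    (h₁ : ∃ g : (Sᶜ : Set V) → Fin c,
      ∀ j : Fin c, TwoIndepOn (G.induce (Sᶜ : Set V)) {v | g v = j})
    (h₂ : ∃ f : (closedNbhd G S) → Fin a ⊕ Fin b,
      (∀ i : Fin a, IndepOn (G.induce (closedNbhd G S)) {v | f v = Sum.inl i}) ∧
      (∀ j : Fin b, TwoIndepOn (G.induce (closedNbhd G S)) {v | f v = Sum.inr j} ∧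
        {v : closedNbhd G S | f v = Sum.inr j ∧ (v : V) ∈ extNbhd G S}.Subsingleton)) :
    ABColorable G a (b + c) := by
  classical
  obtain ⟨g, hg⟩ := h₁
  obtain ⟨f, hfa, hfb⟩ := h₂
  have hcompl {v : V} (h : v ∉ closedNbhd G S) : v ∈ Sᶜ :=
    fun hS => h (subset_closedNbhd G S hS)
  refine ⟨fun v => if h : v ∈ closedNbhd G S then
      Sum.map id (Fin.castAdd c) (f ⟨v, h⟩)
    else Sum.inr (Fin.natAdd b (g ⟨v, hcompl h⟩)), fun i => ?_, fun j => ?_⟩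
  · have key {v : V} (hv : (if h : v ∈ closedNbhd G S then
        Sum.map id (Fin.castAdd c) (f ⟨v, h⟩)
        else Sum.inr (Fin.natAdd b (g ⟨v, hcompl h⟩))) = Sum.inl i) :
        ∃ h : v ∈ closedNbhd G S, f ⟨v, h⟩ = Sum.inl i := by
      split_ifs at hv with h
      refine ⟨h, ?_⟩
      cases hf : f ⟨v, h⟩ <;> simp_all
    intro u hu v hv huv
    obtain ⟨hu', hfu⟩ := key hu
    obtain ⟨hv', hfv⟩ := key hv
    exact hfa i hfu hfv huv
  · induction j using Fin.addCases with
    | left j =>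
      refine ((hfb j).1.image_of_closedNbhd (hfb j).2).mono fun v hv => ?_
      simp only [Set.mem_ofPred_eq] at hv
      split_ifs at hv with h
      · refine ⟨⟨v, h⟩, ?_, rfl⟩
        rw [Set.mem_ofPred_eq]
        cases hf : f ⟨v, h⟩ <;> simp_all
      · have := congrArg Fin.val (Sum.inr.inj hv)
        simp at this
        omega
    | right j =>
      have ht : TwoIndepOn (G.induce (Sᶜ : Set V))
          {v | g v = j ∧ (v : V) ∉ closedNbhd G S} :=
        fun u hu v hv huv => hg j hu.1 hv.1 huv
      refine (ht.image_of_compl fun v hv => hv.2).mono fun v hv => ?_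
      simp only [Set.mem_ofPred_eq] at hv
      split_ifs at hv with h
      · cases hf : f ⟨v, h⟩ with
        | inl i => simp [hf] at hv
        | inr k =>
          rw [hf] at hv
          have := congrArg Fin.val (Sum.inr.inj hv)
          simp at this
          omega
      · exact ⟨⟨v, hcompl h⟩, ⟨by simpa using hv, h⟩, rfl⟩
end

section
/- Let G be a finite simple graph and let S be a set of vertices of G. Then there exists a set S' of vertices of G with S ⊆ S' and |S'| ≤ 3·|S| such that: every connected component of the subgraph of G induced on S' contains a vertex of S, and any two vertices of S' lying in distinct connected components of the subgraph induced on S' are joined by no walk of length at most 3 in G (their distance in G is at least 4). -/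
/-- Adding the support of a walk between distinct vertices `u, v` of `T` to `T` adds at most
`w.length - 1` vertices. -/
theorem SimpleGraph.Walk.ncard_union_support_le {V : Type*} [Finite V] {G : SimpleGraph V}
    {T : Set V} {u v : V} (hu : u ∈ T) (hv : v ∈ T) (huv : u ≠ v) (w : G.Walk u v) :
    (T ∪ {x | x ∈ w.support}).ncard + 1 ≤ T.ncard + w.length := by
  classical
  have hunion := Set.ncard_union_add_ncard_inter T {x | x ∈ w.support}
  have hinter : 2 ≤ (T ∩ {x | x ∈ w.support}).ncard := by
    rw [← Set.ncard_pair huv]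
    refine Set.ncard_le_ncard ?_ (Set.toFinite _)
    rintro x (rfl | rfl)
    · exact ⟨hu, w.start_mem_support⟩
    · exact ⟨hv, w.end_mem_support⟩
  have hsupport : ({x | x ∈ w.support} : Set V).ncard ≤ w.length + 1 := by
    rw [← w.length_support, ← List.coe_toFinset, Set.ncard_coe_finset]
    exact List.toFinset_card_le _
  omega

/-- If every vertex of `T` is connected within `T` to a vertex of `R ⊆ S`, then `T` can be enlarged,
using at most two new vertices for each element of `R`, to a set whose components all meet `S` and
are at pairwise distance at least four. -/
theorem SimpleGraph.exists_superset_components_far {V : Type*} [Finite V] (G : SimpleGraph V)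
    {S R T : Set V} (hRS : R ⊆ S)
    (hT : ∀ v : T, ∃ u : T, (u : V) ∈ R ∧ (G.induce T).Reachable v u) :
    ∃ S' : Set V, T ⊆ S' ∧ S'.ncard ≤ T.ncard + 2 * R.ncard ∧
      (∀ v : S', ∃ u : S', (u : V) ∈ S ∧ (G.induce S').Reachable v u) ∧
      (∀ u v : S', ¬ (G.induce S').Reachable u v →
        ∀ w : G.Walk (u : V) (v : V), 3 < w.length) := by
  induction hn : R.ncard generalizing R T with
  | zero =>
    rw [Set.ncard_eq_zero] at hn
    subst hn
    refine ⟨T, subset_rfl, by omega, fun v => ?_, fun u => ?_⟩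
    · obtain ⟨u, hu, -⟩ := hT v
      exact hu.elim
    · obtain ⟨r, hr, -⟩ := hT u
      exact hr.elim
  | succ n ih =>
    by_cases hfar : ∀ u v : T, ¬ (G.induce T).Reachable u v →
        ∀ w : G.Walk (u : V) (v : V), 3 < w.length
    · refine ⟨T, subset_rfl, by omega, fun v => ?_, hfar⟩
      obtain ⟨u, hu, h⟩ := hT v
      exact ⟨u, hRS hu, h⟩
    push Not at hfar
    obtain ⟨u, v, huv, w, hw⟩ := hfar
    obtain ⟨r, hr, hur⟩ := hT u
    obtain ⟨s, hs, hvs⟩ := hT v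
    have hrs : (r : V) ≠ s := fun h => huv (hur.trans (Subtype.ext h ▸ hvs.symm))
    have hne : (u : V) ≠ v := fun h => huv (Subtype.ext h ▸ .refl _)
    have hcard := w.ncard_union_support_le u.2 v.2 hne
    set T' : Set V := T ∪ {x | x ∈ w.support}
    have hTT' : T ⊆ T' := Set.subset_union_left
    have hwT' : {x | x ∈ w.support} ⊆ T' := Set.subset_union_right
    have lift {x y : T} (h : (G.induce T).Reachable x y) :
        (G.induce T').Reachable ⟨x, hTT' x.2⟩ ⟨y, hTT' y.2⟩ :=
      h.map (G.induceHomOfLE hTT').toHom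
    have hsupp {x y : V} (hx : x ∈ w.support) (hy : y ∈ w.support) :
        (G.induce T').Reachable ⟨x, hwT' hx⟩ ⟨y, hwT' hy⟩ :=
      (w.connected_induce_support.preconnected ⟨x, hx⟩ ⟨y, hy⟩).map
        (G.induceHomOfLE hwT').toHom
    have hr' : (r : V) ∈ R \ {(s : V)} := ⟨hr, hrs⟩
    obtain ⟨S', hS', hS'card, hS'comp⟩ := ih (R := R \ {(s : V)}) (T := T')
      (Set.sdiff_subset.trans hRS) (by
        rintro ⟨x, hx | hx⟩
        · obtain ⟨t, ht, hxt⟩ := hT ⟨x, hx⟩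
          by_cases hts : t = s
          · subst hts
            exact ⟨⟨r, hTT' r.2⟩, hr', (lift (hxt.trans hvs.symm)).trans <|
              (hsupp w.end_mem_support w.start_mem_support).trans (lift hur)⟩
          · exact ⟨⟨t, hTT' t.2⟩, ⟨ht, fun h => hts (Subtype.ext h)⟩, lift hxt⟩
        · exact ⟨⟨r, hTT' r.2⟩, hr', (hsupp hx w.start_mem_support).trans (lift hur)⟩)
      (by rw [Set.ncard_sdiff_singleton_of_mem hs]; omega)
    exact ⟨S', hTT'.trans hS', by omega, hS'comp⟩

theorem stmt_8 {V : Type*} [Fintype V] (G : SimpleGraph V) (S : Set V) :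
    ∃ S' : Set V, S ⊆ S' ∧ S'.ncard ≤ 3 * S.ncard ∧
      (∀ v : (S' : Set V), ∃ u : (S' : Set V), (u : V) ∈ S ∧
        (G.induce (S' : Set V)).Reachable v u) ∧
      (∀ u v : (S' : Set V), ¬ (G.induce (S' : Set V)).Reachable u v →
        ∀ w : G.Walk (u : V) (v : V), 3 < w.length) := by
  obtain ⟨S', hS', hcard, hcomp⟩ :=
    G.exists_superset_components_far (subset_refl S) fun v : S => ⟨v, v.2, .refl _⟩
  exact ⟨S', hS', by omega, hcomp⟩
end

section
/- Let k ≥ 1 be an integer and let G be a finite simple graph on n vertices that admits a graph homomorphism to the cycle graph C_{2k+1} on 2k+1 vertices. Then G contains an independent set of size at least n·k/(2k+1); equivalently, G has a vertex cover of size at most n·(k+1)/(2k+1). -/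
open Finset in
/-- Some translate of a subset `S` of a finite group `A` pulls back along `f : V → A` to at
least a proportion `#S / #A` of `V`. -/
lemma exists_card_mul_le_card_mul_filter_sub {V A : Type*} [Fintype V] [AddGroup A] [Fintype A]
    [DecidableEq A] (f : V → A) (S : Finset A) :
    ∃ t : A, Fintype.card V * #S ≤ Fintype.card A * #{v | f v - t ∈ S} := by
  have hsum : ∑ t : A, #{v | f v - t ∈ S} = Fintype.card V * #S := by
    simp_rw [card_filter]
    rw [sum_comm]
    have key (v : V) : ∑ t : A, (if f v - t ∈ S then 1 else 0) = #S := by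
      have h := Equiv.sum_comp (Equiv.subLeft (f v)) (fun a => if a ∈ S then 1 else 0)
      simp only [Equiv.subLeft_apply] at h
      rw [h]
      simp
    simp [key]
  by_contra! h
  have hlt := sum_lt_sum_of_nonempty (univ_nonempty (α := A)) fun t _ => h t
  rw [← mul_sum, hsum] at hlt
  simp at hlt

open Finset in
lemma le_card_filter_odd_val (k : ℕ) : k ≤ #{x : Fin (2 * k + 1) | Odd x.val} := by
  have h : #(univ : Finset (Fin k)) ≤ #{x : Fin (2 * k + 1) | Odd x.val} := by
    refine card_le_card_of_injOn (fun i => ⟨2 * i.val + 1, by omega⟩) ?_ ?_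
    · intro i _
      simp
    · intro i _ j _ hij
      simp only [Fin.mk.injEq] at hij
      omega
  simpa using h

lemma not_cycleGraph_adj_sub_of_odd {k : ℕ} {a b t : Fin (2 * k + 1)}
    (ha : Odd (a - t).val) (hb : Odd (b - t).val) :
    ¬ (SimpleGraph.cycleGraph (2 * k + 1)).Adj a b := by
  have key (x y : Fin (2 * k + 1)) (hx : Odd x.val) (hy : Odd y.val) : (x - y).val ≠ 1 := by
    intro h
    rw [Nat.odd_iff] at hx hy
    rcases le_or_gt y x with hxy | hxy
    · rw [Fin.coe_sub_iff_le.mpr hxy] at h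
      omega
    · rw [Fin.coe_sub_iff_lt.mpr hxy] at h
      omega
  rw [SimpleGraph.cycleGraph_adj', ← sub_sub_sub_cancel_right a b t,
    ← sub_sub_sub_cancel_right b a t]
  exact not_or.mpr ⟨key _ _ ha hb, key _ _ hb ha⟩

theorem stmt_9 {V : Type*} [Fintype V] (k : ℕ) (hk : 1 ≤ k) (G : SimpleGraph V)
    (f : G →g SimpleGraph.cycleGraph (2 * k + 1)) :
    (∃ I : Finset V, IndepOn G (↑I : Set V) ∧
      ((Fintype.card V : ℝ) * k / (2 * k + 1) ≤ (I.card : ℝ))) ∧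
    (∃ C : Finset V, (∀ u v : V, G.Adj u v → u ∈ C ∨ v ∈ C) ∧
      ((C.card : ℝ) ≤ (Fintype.card V : ℝ) * (k + 1) / (2 * k + 1))) := by
  classical
  obtain ⟨t, ht⟩ := exists_card_mul_le_card_mul_filter_sub f
    (Finset.univ.filter fun x : Fin (2 * k + 1) => Odd x.val)
  set I : Finset V := Finset.univ.filter
    fun v => f v - t ∈ Finset.univ.filter fun x : Fin (2 * k + 1) => Odd x.val with hI
  have hmem {v : V} (hv : v ∈ I) : Odd (f v - t).val := by simpa [hI] using hv
  have hindep : IndepOn G (↑I : Set V) := fun u hu v hv huv =>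
    not_cycleGraph_adj_sub_of_odd (hmem hu) (hmem hv) (f.map_adj huv)
  have hcard : (Fintype.card V : ℝ) * k ≤ (2 * k + 1) * I.card := by
    rw [Fintype.card_fin] at ht
    exact_mod_cast (Nat.mul_le_mul_left _ (le_card_filter_odd_val k)).trans ht
  have hpos : (0 : ℝ) < 2 * k + 1 := by positivity
  refine ⟨⟨I, hindep, ?_⟩, Iᶜ, fun u v huv => ?_, ?_⟩
  · rw [div_le_iff₀ hpos]
    linarith
  · by_contra! h
    simp only [Finset.mem_compl, not_not] at h
    exact hindep h.1 h.2 huv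
  · rw [le_div_iff₀ hpos, Finset.card_compl, Nat.cast_sub (Finset.card_le_univ I)]
    linarith
end

section
/- Let k ≥ 1 be an integer and let F be the finite simple graph with vertex set {s} ∪ {x_1, y_1, …, x_{k+1}, y_{k+1}} whose edges are exactly s–x_i, s–y_i and x_i–y_i for 1 ≤ i ≤ k+1 (that is, k+1 triangles all sharing the single vertex s). Then F is (2,1)-colorable, and in every partition of the vertex set of F into 2 independent sets and k 2-independent sets, the vertex s belongs to one of the 2-independent sets. -/
/-- The graph made of `k + 1` triangles all sharing the single vertex `s`
(represented by `none`); `some (i, false)` is `x_i` and `some (i, true)` is `y_i`. -/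
def sharedTriangles (k : ℕ) : SimpleGraph (Option (Fin (k + 1) × Bool)) :=
  SimpleGraph.fromRel (fun u v =>
    (u = none ∧ v ≠ none) ∨ (∃ i : Fin (k + 1), u = some (i, false) ∧ v = some (i, true)))

theorem sharedTriangles_adj_none_some (k : ℕ) (p : Fin (k + 1) × Bool) :
    (sharedTriangles k).Adj none (some p) := by
  simp [sharedTriangles]

theorem sharedTriangles_adj_some_some (k : ℕ) (i j : Fin (k + 1)) (a b : Bool) :
    (sharedTriangles k).Adj (some (i, a)) (some (j, b)) ↔ i = j ∧ a ≠ b := by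
  cases a <;> cases b <;> simp [sharedTriangles, eq_comm]

theorem sharedTriangles_abColorable (k : ℕ) : ABColorable (sharedTriangles k) 2 1 := by
  refine ⟨fun v => v.elim (Sum.inr 0) fun p => Sum.inl (if p.2 then 1 else 0), ?_, ?_⟩
  · rintro c (_ | ⟨i, a⟩) hu (_ | ⟨j, b⟩) hv
    · simp at hu
    · simp at hu
    · simp at hv
    · rw [sharedTriangles_adj_some_some]
      rintro ⟨-, hab⟩
      cases a <;> cases b <;> simp at hu hv hab <;> omega
  · rintro c (_ | p) hu (_ | q) hv huv
    · exact absurd rfl huv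
    · simp at hv
    · simp at hu
    · simp at hu

/-- If `s` lies in an independent class, then each triangle has another vertex in a
2-independent class. -/
theorem exists_some_eq_inr {k b : ℕ} {f : Option (Fin (k + 1) × Bool) → Fin 2 ⊕ Fin b}
    (hf : ∀ i : Fin 2, IndepOn (sharedTriangles k) {v | f v = Sum.inl i})
    {c : Fin 2} (hc : f none = Sum.inl c) (i : Fin (k + 1)) :
    ∃ (a : Bool) (j : Fin b), f (some (i, a)) = Sum.inr j := by
  by_contra! h
  have hl (a : Bool) : ∃ d : Fin 2, f (some (i, a)) = Sum.inl d ∧ c ≠ d := by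
    rcases hd : f (some (i, a)) with d | j
    · refine ⟨d, rfl, ?_⟩
      rintro rfl
      exact hf c hc hd (sharedTriangles_adj_none_some k (i, a))
    · exact absurd hd (h a j)
  obtain ⟨d, hd, hcd⟩ := hl false
  obtain ⟨e, he, hce⟩ := hl true
  obtain rfl : d = e := by omega
  exact hf d hd he ((sharedTriangles_adj_some_some k i i false true).2 (by simp))

theorem stmt_10 (k : ℕ) (hk : 1 ≤ k) :
    ABColorable (sharedTriangles k) 2 1 ∧
    ∀ f : Option (Fin (k + 1) × Bool) → Fin 2 ⊕ Fin k,
      (∀ i : Fin 2, IndepOn (sharedTriangles k) {v | f v = Sum.inl i}) →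
      (∀ j : Fin k, TwoIndepOn (sharedTriangles k) {v | f v = Sum.inr j}) →
      ∃ j : Fin k, f none = Sum.inr j := by
  refine ⟨sharedTriangles_abColorable k, fun f hf hg => ?_⟩
  rcases hc : f none with c | j
  · choose a j hj using exists_some_eq_inr hf hc
    obtain ⟨x, y, hxy, hj'⟩ := Fintype.exists_ne_map_eq_of_card_lt j (by simp)
    have hy : f (some (y, a y)) = Sum.inr (j x) := hj' ▸ hj y
    exact absurd
      ⟨(sharedTriangles_adj_none_some k (x, a x)).symm, sharedTriangles_adj_none_some k (y, a y)⟩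
      ((hg (j x) (hj x) hy (by simp [hxy])).2 none)
  · exact ⟨j, rfl⟩
end

section
/- For every integer k ≥ 1, there exists a triangle-free finite simple graph (a graph with no cycle of length 3) of order 12k² + 16k + 7 that is not (2,k)-colorable. -/
/-- The balanced blow-up of the 5-cycle with parts of size `m`, on the vertices less than `5 * m`
of `Fin n` (the part of a vertex is its residue modulo 5), together with isolated vertices. -/
def cycleFiveBlowup (m n : ℕ) : SimpleGraph (Fin n) where
  Adj u v := u.val < 5 * m ∧ v.val < 5 * m ∧
    ((u.val + 1) % 5 = v.val % 5 ∨ (v.val + 1) % 5 = u.val % 5)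
  symm := ⟨fun _ _ h => ⟨h.2.1, h.1, h.2.2.symm⟩⟩
  loopless := ⟨fun u h => by have := h.2.2; omega⟩

theorem cycleFiveBlowup_not_triangle {m n : ℕ} {u v w : Fin n}
    (huv : (cycleFiveBlowup m n).Adj u v) (hvw : (cycleFiveBlowup m n).Adj v w) :
    ¬ (cycleFiveBlowup m n).Adj w u := by
  intro hwu
  have h₁ := huv.2.2
  have h₂ := hvw.2.2
  have h₃ := hwu.2.2
  omega

/-- In a colouring with `k` 2-independent classes, every part of size `k + 1` of the blow-up
has a vertex in one of the independent classes. -/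
theorem cycleFiveBlowup_exists_inl {a k n : ℕ} (hn : 5 * (k + 1) ≤ n) {f : Fin n → Fin a ⊕ Fin k}
    (hf : ∀ j : Fin k, TwoIndepOn (cycleFiveBlowup (k + 1) n) {v | f v = Sum.inr j})
    {r : ℕ} (hr : r < 5) :
    ∃ (v : Fin n) (i : Fin a), v.val < 5 * (k + 1) ∧ v.val % 5 = r ∧ f v = Sum.inl i := by
  by_contra! hcon
  let p : Fin (k + 1) → Fin n := fun j => ⟨5 * j.val + r, by omega⟩
  have hp : ∀ j, ∃ c : Fin k, f (p j) = Sum.inr c := by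
    intro j
    rcases h : f (p j) with i | c
    · exact absurd h (hcon (p j) i (by simp only [p]; omega) (by simp only [p]; omega))
    · exact ⟨c, rfl⟩
  choose g hg using hp
  obtain ⟨x, y, hxy, hgxy⟩ := Fintype.exists_ne_map_eq_of_card_lt g (by simp)
  have hne : p x ≠ p y := by
    intro h
    apply hxy
    have h' := congrArg Fin.val h
    simp only [p] at h'
    exact Fin.ext (by omega)
  refine (hf (g x) (hg x) (by rw [hgxy]; exact hg y) hne).2 ⟨(r + 1) % 5, by omega⟩
    ⟨⟨?_, ?_, Or.inl ?_⟩, ⟨?_, ?_, Or.inr ?_⟩⟩ <;> simp only [p] <;> omega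

theorem cycleFiveBlowup_not_abColorable {k n : ℕ} (hn : 5 * (k + 1) ≤ n) :
    ¬ ABColorable (cycleFiveBlowup (k + 1) n) 2 k := by
  rintro ⟨f, hind, htwo⟩
  have hsep : ∀ {u v : Fin n} {i j : Fin 2}, f u = Sum.inl i → f v = Sum.inl j →
      (cycleFiveBlowup (k + 1) n).Adj u v → i.val ≠ j.val := by
    intro u v i j hu hv huv hij
    have hij' : i = j := Fin.ext hij
    subst hij'
    exact hind i hu hv huv
  obtain ⟨v₀, i₀, h₀, m₀, c₀⟩ := cycleFiveBlowup_exists_inl hn htwo (r := 0) (by norm_num)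
  obtain ⟨v₁, i₁, h₁, m₁, c₁⟩ := cycleFiveBlowup_exists_inl hn htwo (r := 1) (by norm_num)
  obtain ⟨v₂, i₂, h₂, m₂, c₂⟩ := cycleFiveBlowup_exists_inl hn htwo (r := 2) (by norm_num)
  obtain ⟨v₃, i₃, h₃, m₃, c₃⟩ := cycleFiveBlowup_exists_inl hn htwo (r := 3) (by norm_num)
  obtain ⟨v₄, i₄, h₄, m₄, c₄⟩ := cycleFiveBlowup_exists_inl hn htwo (r := 4) (by norm_num)
  have e₀ := hsep c₀ c₁ ⟨h₀, h₁, by omega⟩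
  have e₁ := hsep c₁ c₂ ⟨h₁, h₂, by omega⟩
  have e₂ := hsep c₂ c₃ ⟨h₂, h₃, by omega⟩
  have e₃ := hsep c₃ c₄ ⟨h₃, h₄, by omega⟩
  have e₄ := hsep c₄ c₀ ⟨h₄, h₀, by omega⟩
  omega

theorem stmt_12 (k : ℕ) (hk : 1 ≤ k) :
    ∃ G : SimpleGraph (Fin (12 * k ^ 2 + 16 * k + 7)),
      (∀ (v : Fin (12 * k ^ 2 + 16 * k + 7)) (c : G.Walk v v), c.IsCycle → c.length ≠ 3) ∧
      ¬ ABColorable G 2 k := by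
  have hn : 5 * (k + 1) ≤ 12 * k ^ 2 + 16 * k + 7 := by nlinarith
  refine ⟨cycleFiveBlowup (k + 1) _, ?_, cycleFiveBlowup_not_abColorable hn⟩
  intro v c _ hlen
  match c, hlen with
  | .cons h₁ (.cons h₂ (.cons h₃ .nil)), _ => exact cycleFiveBlowup_not_triangle h₁ h₂ h₃
end

section
/- For every integer k ≥ 1, there exists a finite simple graph of girth at least 5 (containing no cycle of length 3 or 4) and of order 8k³ + 24k² + 25k + 10 that is not (2,k)-colorable. -/
open SimpleGraph

/-- A graph with a cycle, but with neither triangles nor four-cycles, has girth at least `5`. -/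
theorem five_le_girth {V : Type*} {G : SimpleGraph V} (hG : ¬ G.IsAcyclic)
    (h₃ : ∀ a b c, G.Adj a b → G.Adj b c → ¬ G.Adj c a)
    (h₄ : ∀ a b c d, a ≠ c → b ≠ d → G.Adj a b → G.Adj b c → G.Adj c d → ¬ G.Adj d a) :
    5 ≤ G.girth := by
  obtain ⟨a, w, hw, hlen⟩ := exists_girth_eq_length.mpr hG
  rw [hlen]
  by_contra! hlt
  have h3 := hw.three_le_length
  match w, hw, hlt, h3 with
  | .cons hab (.cons hbc (.cons hca .nil)), _, _, _ => exact h₃ _ _ _ hab hbc hca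
  | .cons hab (.cons hbc (.cons hcd (.cons hda .nil))), hw, _, _ =>
    have hnd := hw.support_nodup
    simp only [Walk.support_cons, Walk.support_nil, List.tail_cons, List.nodup_cons,
      List.mem_cons, List.not_mem_nil, or_false, not_or] at hnd
    exact h₄ _ _ _ _ (Ne.symm hnd.2.1.2) hnd.1.2.1 hab hbc hcd hda
  | .cons _ (.cons _ (.cons _ (.cons _ (.cons _ _)))), _, hlt, _ =>
    simp only [Walk.length_cons] at hlt
    omega

/-- Colorability passes to subgraphs. -/
theorem ABColorable.of_map {V W : Type*} {G : SimpleGraph V} (e : V ↪ W) {a b : ℕ}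
    (h : ABColorable (G.map e) a b) : ABColorable G a b := by
  obtain ⟨f, hI, hT⟩ := h
  have he {u v} (huv : G.Adj u v) : (G.map e).Adj (e u) (e v) :=
    (SimpleGraph.map_adj_apply).mpr huv
  refine ⟨f ∘ e, fun i u hu v hv huv => hI i hu hv (he huv), fun j u hu v hv huv => ?_⟩
  obtain ⟨h₁, h₂⟩ := hT j hu hv (e.injective.ne huv)
  exact ⟨fun h => h₁ (he h), fun w hw => h₂ (e w) ⟨he hw.1, he hw.2⟩⟩

/-- An `a`-colorable graph is `(a,b)`-colorable. -/
theorem ABColorable.of_colorable {V : Type*} {G : SimpleGraph V} {a : ℕ} (b : ℕ)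
    (h : G.Colorable a) : ABColorable G a b := by
  obtain ⟨C⟩ := h
  refine ⟨fun v => Sum.inl (C v), fun i u hu v hv huv => C.valid huv ?_, fun j u hu => ?_⟩
  · exact Sum.inl_injective (hu.trans hv.symm)
  · simp at hu

/-- The vertices of `hub n d`: a root, `n` hubs, and for all hubs `i` and `j`
and each `t < d` a vertex `(i, j, t)`. -/
abbrev HubVertex (n d : ℕ) : Type := Option (Fin n ⊕ Fin n × Fin n × Fin d)

/-- Adjacency in `hub n d`. -/
def HubAdj {n d : ℕ} : HubVertex n d → HubVertex n d → Prop
  | none, some (.inl _) => True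
  | some (.inl _), none => True
  | some (.inl i), some (.inr p) => i = p.1
  | some (.inr p), some (.inl i) => i = p.1
  | some (.inr p), some (.inr q) => p.1 = q.2.1 ∧ p.2.1 = q.1 ∧ p.2.2 = q.2.2 ∧ p.1 ≠ p.2.1
  | _, _ => False

/-- The graph in which the root is joined to all hubs, and any two hubs `i ≠ j` are joined
by the `d` paths `i, (i, j, t), (j, i, t), j` of length three. -/
def hub (n d : ℕ) : SimpleGraph (HubVertex n d) where
  Adj := HubAdj
  symm := ⟨by rintro (_ | _ | _) (_ | _ | _) <;> grind [HubAdj]⟩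
  loopless := ⟨by rintro (_ | _ | _) <;> grind [HubAdj]⟩

theorem hub_no_triangle {n d : ℕ} (a b c : HubVertex n d) (h₁ : (hub n d).Adj a b)
    (h₂ : (hub n d).Adj b c) : ¬ (hub n d).Adj c a := by
  change HubAdj _ _ at h₁ h₂
  change ¬ HubAdj _ _
  rcases a with _ | _ | ⟨_, _, _⟩ <;> rcases b with _ | _ | ⟨_, _, _⟩ <;>
    rcases c with _ | _ | ⟨_, _, _⟩ <;> grind [HubAdj]

theorem hub_no_four_cycle {n d : ℕ} (a b c e : HubVertex n d) (hac : a ≠ c) (hbe : b ≠ e)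
    (h₁ : (hub n d).Adj a b) (h₂ : (hub n d).Adj b c) (h₃ : (hub n d).Adj c e) :
    ¬ (hub n d).Adj e a := by
  change HubAdj _ _ at h₁ h₂ h₃
  change ¬ HubAdj _ _
  rcases a with _ | _ | ⟨_, _, _⟩ <;> rcases b with _ | _ | ⟨_, _, _⟩ <;>
    rcases c with _ | _ | ⟨_, _, _⟩ <;> rcases e with _ | _ | ⟨_, _, _⟩ <;> grind [HubAdj]

/-- Among neighbors of a fixed vertex, at most `k` lie in the `k` given `2`-independent classes. -/
theorem card_filter_isRight_le {V ι : Type*} [Fintype ι] {G : SimpleGraph V} {a k : ℕ}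
    {f : V → Fin a ⊕ Fin k} (hf : ∀ j : Fin k, TwoIndepOn G {v | f v = Sum.inr j}) (v : V)
    (g : ι → V) (hg : Function.Injective g) (hv : ∀ i, G.Adj v (g i)) :
    (Finset.univ.filter fun i => (f (g i)).isRight = true).card ≤ k := by
  classical
  by_contra! hlt
  have hcard : (Finset.univ.image (Sum.inr : Fin k → Fin a ⊕ Fin k)).card <
      (Finset.univ.filter fun i => (f (g i)).isRight = true).card :=
    (Finset.card_image_le.trans_eq (by simp)).trans_lt hlt
  obtain ⟨x, hx, y, hy, hxy, hfxy⟩ := Finset.exists_ne_map_eq_of_card_lt_of_maps_to hcard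
    (f := fun i => f (g i)) (by
      intro i hi
      obtain ⟨j, hj⟩ := Sum.isRight_iff.mp (Finset.mem_filter.mp hi).2
      simp [hj])
  obtain ⟨j, hj⟩ := Sum.isRight_iff.mp (Finset.mem_filter.mp hx).2
  exact (hf j hj (hfxy.symm.trans hj) (hg.ne hxy)).2 v ⟨(hv x).symm, hv y⟩

theorem not_abColorable_hub (k : ℕ) : ¬ ABColorable (hub (k + 3) (2 * k + 1)) 2 k := by
  rintro ⟨f, hI, hT⟩
  have hroot := card_filter_isRight_le hT none (fun i : Fin (k + 3) => some (.inl i))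
    (fun i j h => by simpa using h) (fun i => trivial)
  obtain ⟨i, j, hij, c, hi, hj⟩ : ∃ i j : Fin (k + 3), i ≠ j ∧ ∃ c,
      f (some (.inl i)) = .inl c ∧ f (some (.inl j)) = .inl c := by
    have hsum := Finset.card_filter_add_card_filter_not (s := (Finset.univ : Finset (Fin (k + 3))))
      (fun i => (f (some (.inl i))).isRight = true)
    rw [Finset.card_univ, Fintype.card_fin] at hsum
    obtain ⟨i, hi, j, hj, hij, h⟩ := Finset.exists_ne_map_eq_of_card_lt_of_maps_to
      (s := Finset.univ.filter fun i => ¬ (f (some (.inl i))).isRight = true)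
      (t := Finset.univ.image (Sum.inl : Fin 2 → Fin 2 ⊕ Fin k))
      (f := fun i : Fin (k + 3) => f (some (.inl i)))
      ((Finset.card_image_le.trans_eq (by simp)).trans_lt (by omega : 2 < _)) (by
        intro i hi
        obtain ⟨c, hc⟩ := Sum.isLeft_iff.mp (by simpa using (Finset.mem_filter.mp hi).2)
        simp [hc])
    obtain ⟨c, hc⟩ := Sum.isLeft_iff.mp (by simpa using (Finset.mem_filter.mp hi).2)
    exact ⟨i, j, hij, c, hc, h.symm.trans hc⟩
  have hside (i j : Fin (k + 3)) := card_filter_isRight_le hT (some (.inl i))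
    (fun t : Fin (2 * k + 1) => some (.inr (i, j, t))) (fun s t h => by simpa using h)
    (fun t => rfl)
  obtain ⟨t, ht⟩ : ∃ t : Fin (2 * k + 1), t ∉
      (Finset.univ.filter fun t => (f (some (.inr (i, j, t)))).isRight = true) ∪
      (Finset.univ.filter fun t => (f (some (.inr (j, i, t)))).isRight = true) := by
    by_contra! hall
    have h := Finset.card_le_card (Finset.subset_iff.mpr fun t (_ : t ∈ Finset.univ) => hall t)
    rw [Finset.card_univ, Fintype.card_fin] at h
    have := h.trans (Finset.card_union_le _ _)
    have := hside i j
    have := hside j i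
    omega
  simp only [Finset.mem_union, Finset.mem_filter, Finset.mem_univ, true_and, not_or,
    Sum.not_isRight, Sum.isLeft_iff] at ht
  obtain ⟨⟨x, hx⟩, y, hy⟩ := ht
  have hxc : c ≠ x := by
    rintro rfl
    exact hI c hi hx rfl
  have hyc : c ≠ y := by
    rintro rfl
    exact hI c hj hy rfl
  obtain rfl : x = y := by omega
  exact hI x hx hy ⟨rfl, rfl, rfl, hij⟩

theorem stmt_13 (k : ℕ) (hk : 1 ≤ k) :
    ∃ G : SimpleGraph (Fin (8 * k ^ 3 + 24 * k ^ 2 + 25 * k + 10)),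
      5 ≤ G.girth ∧ ¬ ABColorable G 2 k := by
  obtain ⟨e⟩ : Nonempty (HubVertex (k + 3) (2 * k + 1) ↪
      Fin (8 * k ^ 3 + 24 * k ^ 2 + 25 * k + 10)) := by
    apply Function.Embedding.nonempty_of_card_le
    simp only [Fintype.card_option, Fintype.card_sum, Fintype.card_prod, Fintype.card_fin]
    nlinarith [Nat.one_le_pow 2 k hk, Nat.zero_le (k ^ 3)]
  have hcol : ¬ ABColorable ((hub (k + 3) (2 * k + 1)).map e) 2 k :=
    fun h => not_abColorable_hub k h.of_map
  refine ⟨_, five_le_girth (fun h => hcol (.of_colorable k h.isBipartite)) ?_ ?_, hcol⟩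
  · rintro _ _ _ ⟨-, a, b, hab, rfl, rfl⟩ ⟨-, b', c, hbc, hb, rfl⟩ ⟨-, c', a', hca, hc, ha⟩
    obtain rfl := e.injective hb
    obtain rfl := e.injective hc
    obtain rfl := e.injective ha
    exact hub_no_triangle _ _ _ hab hbc hca
  · rintro _ _ _ _ hac hbd ⟨-, a, b, hab, rfl, rfl⟩ ⟨-, b', c, hbc, hb, rfl⟩ ⟨-, c', d, hcd, hc, rfl⟩
      ⟨-, d', a', hda, hd, ha⟩
    obtain rfl := e.injective hb
    obtain rfl := e.injective hc
    obtain rfl := e.injective hd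
    obtain rfl := e.injective ha
    exact hub_no_four_cycle _ _ _ _ (ne_of_apply_ne e hac) (ne_of_apply_ne e hbd) hab hbc hcd hda
end

section
/- Let g ≥ 3 and k ≥ 1 be integers. Suppose there exists a finite simple graph G of girth at least g that is (2,k)-colorable and that has a vertex s such that in every partition of the vertex set of G into 2 independent sets and k 2-independent sets, s belongs to one of the 2-independent sets. Then there exists a finite simple graph of girth at least g that is not (2,k)-colorable. -/
/-- The disjoint union of copies of `G` indexed by `ι`, together with a new vertex `none`
joined to the copy of `s` in each of them. -/
def starOfCopies {V : Type*} (G : SimpleGraph V) (s : V) (ι : Type*) :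
    SimpleGraph (Option (ι × V)) where
  Adj
    | none, none => False
    | none, some (_, v) => v = s
    | some (_, u), none => u = s
    | some (i, u), some (j, v) => i = j ∧ G.Adj u v
  symm := ⟨by
    rintro (_ | ⟨i, u⟩) (_ | ⟨j, v⟩) h
    · exact h
    · exact h
    · exact h
    · exact ⟨h.1.symm, h.2.symm⟩⟩
  loopless := ⟨by
    rintro (_ | ⟨i, u⟩) h
    · exact h
    · exact G.loopless.irrefl u h.2⟩

namespace starOfCopies

variable {V ι : Type*} {G : SimpleGraph V} {s : V}

/-- The inclusion of the copy of `G` with index `i`. -/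
def copyHom (G : SimpleGraph V) (s : V) (i : ι) : G →g starOfCopies G s ι where
  toFun v := some (i, v)
  map_rel' h := ⟨rfl, h⟩

theorem copyHom_injective (i : ι) : Function.Injective (copyHom G s i) := by
  intro u v h
  exact congrArg Prod.snd (Option.some.inj h)

theorem isBridge (i : ι) : (starOfCopies G s ι).IsBridge s(none, some (i, s)) := by
  rw [SimpleGraph.isBridge_iff]
  rintro ⟨p⟩
  have inv : ∀ {x y : Option (ι × V)},
      ((starOfCopies G s ι).deleteEdges {s(none, some (i, s))}).Walk x y →
      ((∃ v, x = some (i, v)) ↔ ∃ v, y = some (i, v)) := by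
    intro x y p
    induction p with
    | nil => rfl
    | @cons x y z h _ ih =>
      rw [← ih]
      rw [SimpleGraph.deleteEdges_adj] at h
      obtain ⟨h, hne⟩ := h
      rcases x with _ | ⟨j, u⟩ <;> rcases y with _ | ⟨l, v⟩
      · rfl
      · obtain rfl : v = s := h
        simp_all [eq_comm]
      · obtain rfl : u = s := h
        simp_all [eq_comm]
      · obtain ⟨rfl, -⟩ := h
        simp
  simpa using inv p

theorem exists_walk_of_none_notMem_support (i : ι) {x y : Option (ι × V)}
    (p : (starOfCopies G s ι).Walk x y) (hp : none ∉ p.support) (u : V) (hx : x = some (i, u)) :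
    ∃ (v : V) (hy : y = some (i, v)) (q : G.Walk u v), p.copy hx hy = q.map (copyHom G s i) := by
  induction p generalizing u with
  | nil => exact ⟨u, hx, .nil, by subst hx; rfl⟩
  | @cons x y z h p ih =>
    subst hx
    rw [SimpleGraph.Walk.support_cons, List.mem_cons, not_or] at hp
    rcases y with _ | ⟨j, w⟩
    · exact absurd p.start_mem_support hp.2
    · obtain ⟨rfl, hadj⟩ := id h
      obtain ⟨v, rfl, q, hq⟩ := ih hp.2 w rfl
      refine ⟨v, rfl, .cons hadj q, ?_⟩
      rw [SimpleGraph.Walk.copy_rfl_rfl] at hq ⊢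
      rw [hq]
      rfl

theorem none_notMem_support_of_isCycle {x : Option (ι × V)}
    (p : (starOfCopies G s ι).Walk x x) (hp : p.IsCycle) : none ∉ p.support := by
  classical
  intro hmem
  have hc := hp.rotate hmem
  generalize p.rotate _ hmem = q at hc
  cases q with
  | nil => exact SimpleGraph.Walk.not_isCycle_nil hc
  | @cons _ y _ h q =>
    rcases y with _ | ⟨i, v⟩
    · exact h
    · obtain rfl : v = s := h
      exact (isBridge i).notMem_edges_of_isCycle hc List.mem_cons_self

theorem egirth_le : G.egirth ≤ (starOfCopies G s ι).egirth := by
  rw [SimpleGraph.le_egirth]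
  intro x p hp
  have hnone := none_notMem_support_of_isCycle p hp
  rcases x with _ | ⟨i, u⟩
  · exact absurd p.start_mem_support hnone
  · obtain ⟨v, hv, q, hq⟩ := exists_walk_of_none_notMem_support i p hnone u rfl
    obtain rfl : u = v := by simpa using hv
    rw [SimpleGraph.Walk.copy_rfl_rfl] at hq
    subst hq
    have hq := (SimpleGraph.Walk.isCycle_map_iff_of_injective (copyHom_injective i)).mp hp
    exact (SimpleGraph.egirth_le_length hq).trans_eq
      (congrArg _ (q.length_map (copyHom G s i)).symm)

theorem girth_le [Nonempty ι] (hG : ¬ G.IsAcyclic) : G.girth ≤ (starOfCopies G s ι).girth := by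
  refine ENat.toNat_le_toNat egirth_le ?_
  rw [Ne, SimpleGraph.egirth_eq_top]
  intro hH
  exact hG (hH.comap (copyHom G s (Classical.arbitrary ι)) (copyHom_injective _))

theorem not_abColorable {a b : ℕ} (hι : b < Nat.card ι)
    (hs : ∀ f : V → Fin a ⊕ Fin b,
      (∀ i : Fin a, IndepOn G {v | f v = Sum.inl i}) →
      (∀ j : Fin b, TwoIndepOn G {v | f v = Sum.inr j}) →
      ∃ j : Fin b, f s = Sum.inr j) :
    ¬ ABColorable (starOfCopies G s ι) a b := by
  rintro ⟨f, hf₁, hf₂⟩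
  have hcolor (i : ι) : ∃ j : Fin b, f (some (i, s)) = Sum.inr j := by
    refine hs (fun v ↦ f (some (i, v))) ?_ ?_
    · intro c u hu v hv huv
      exact hf₁ c hu hv ⟨rfl, huv⟩
    · intro c u hu v hv huv
      obtain ⟨h₁, h₂⟩ := hf₂ c hu hv (by simpa using huv)
      exact ⟨fun h ↦ h₁ ⟨rfl, h⟩, fun w h ↦ h₂ (some (i, w)) ⟨⟨rfl, h.1⟩, ⟨rfl, h.2⟩⟩⟩
  choose c hc using hcolor
  have hinj : Function.Injective c := by
    intro i j hij
    by_contra hne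
    exact (hf₂ (c i) (hc i) ((hc j).trans (by rw [hij])) (by simpa using hne)).2 none
      ⟨rfl, rfl⟩
  have := Nat.card_le_card_of_injective c hinj
  rw [Nat.card_fin] at this
  omega

end starOfCopies

theorem stmt_15 (g k : ℕ) (hg : 3 ≤ g) (hk : 1 ≤ k)
    (h : ∃ (V : Type) (_ : Fintype V) (G : SimpleGraph V) (s : V),
      (g : ℕ∞) ≤ G.girth ∧ ABColorable G 2 k ∧
      ∀ f : V → Fin 2 ⊕ Fin k,
        (∀ i : Fin 2, IndepOn G {v | f v = Sum.inl i}) →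
        (∀ j : Fin k, TwoIndepOn G {v | f v = Sum.inr j}) →
        ∃ j : Fin k, f s = Sum.inr j) :
    ∃ (W : Type) (_ : Fintype W) (H : SimpleGraph W),
      (g : ℕ∞) ≤ H.girth ∧ ¬ ABColorable H 2 k := by
  obtain ⟨V, _, G, s, hgirth, -, hs⟩ := h
  have hG : ¬ G.IsAcyclic := by
    intro hacyc
    rw [hacyc.girth_eq_zero] at hgirth
    norm_cast at hgirth
    omega
  refine ⟨Option (Fin (k + 1) × V), inferInstance, starOfCopies G s (Fin (k + 1)), ?_, ?_⟩
  · exact hgirth.trans (by exact_mod_cast starOfCopies.girth_le hG)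
  · exact starOfCopies.not_abColorable (by simp) hs
end
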